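/- Let d ≥ 10 be a constant and let G ~ G(n, d/n). Then with probability 1 − o(n^{−1}) one has |V_{4,blue}(G)| ≥ 0.1·(2d)³·e^{−2d}·n. -/

import Mathlib

open Filter

/-- A set `S` of vertices of `G` is a "strong `k`-set" if every vertex of
`S ∪ N(S)` has at least `k` neighbours in `S`. -/
def IsStrongSet {V : Type*} (G : SimpleGraph V) (k : ℕ) (S : Set V) : Prop :=
  ∀ v, v ∈ S ∪ {x | ∃ s ∈ S, G.Adj x s} → k ≤ {u | u ∈ S ∧ G.Adj v u}.ncard

/-- The strong `k`-core `V_{k,black}(G)` of `G`: the maximal strong `k`-set,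
i.e. the union of all strong `k`-sets. -/
def strongCore {V : Type*} (G : SimpleGraph V) (k : ℕ) : Set V :=
  ⋃₀ {S | IsStrongSet G k S}

/-- `V_{k,blue}(G)`: the neighbourhood of the strong `k`-core, minus the core. -/
def strongBlue {V : Type*} (G : SimpleGraph V) (k : ℕ) : Set V :=
  {v | v ∉ strongCore G k ∧ ∃ u ∈ strongCore G k, G.Adj v u}

/-- The non-diagonal edges of the complete graph on `Fin n`. -/
def allEdges (n : ℕ) : Finset (Sym2 (Fin n)) :=
  Finset.univ.filter fun e => ¬ e.IsDiag

/-- The probability that the binomial random graph `G(n,p)` (each of the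
`C(n,2)` possible edges present independently with probability `p`) satisfies
the predicate `Q`. -/
noncomputable def prG (n : ℕ) (p : ℝ) (Q : SimpleGraph (Fin n) → Prop) : ℝ :=
  ∑ S ∈ (allEdges n).powerset,
    Set.indicator {S : Finset (Sym2 (Fin n)) | Q (SimpleGraph.fromEdgeSet ↑S)}
      (fun S => p ^ S.card * (1 - p) ^ ((allEdges n).card - S.card)) S

open Classical in
theorem mul_prG_le_sum {n : ℕ} {p : ℝ} (h0 : 0 ≤ p) (h1 : p ≤ 1) {ι : Type*} (s : Finset ι)
    (Q : SimpleGraph (Fin n) → Prop) (R : ι → SimpleGraph (Fin n) → Prop) (c : ℝ)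
    (h : ∀ G, Q G → c ≤ ((s.filter fun i => R i G).card : ℝ)) :
    c * prG n p Q ≤ ∑ i ∈ s, prG n p (R i) := by
  unfold prG
  rw [Finset.mul_sum, Finset.sum_comm]
  refine Finset.sum_le_sum fun S _ => ?_
  have hw : 0 ≤ p ^ S.card * (1 - p) ^ ((allEdges n).card - S.card) :=
    mul_nonneg (pow_nonneg h0 _) (pow_nonneg (by linarith) _)
  have hsum : ∑ i ∈ s, Set.indicator
      {S : Finset (Sym2 (Fin n)) | R i (SimpleGraph.fromEdgeSet (S : Set (Sym2 (Fin n))))}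
      (fun S => p ^ S.card * (1 - p) ^ ((allEdges n).card - S.card)) S
      = ((s.filter fun i => R i (SimpleGraph.fromEdgeSet (S : Set (Sym2 (Fin n))))).card : ℝ)
        * (p ^ S.card * (1 - p) ^ ((allEdges n).card - S.card)) := by
    simp only [Set.indicator_apply, Set.mem_ofPred_eq]
    rw [← Finset.sum_filter, Finset.sum_const, nsmul_eq_mul]
  rw [hsum]
  by_cases hQ : Q (SimpleGraph.fromEdgeSet (S : Set (Sym2 (Fin n))))
  · rw [Set.indicator_of_mem (by exact hQ)]
    exact mul_le_mul_of_nonneg_right (h _ hQ) hw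
  · rw [Set.indicator_of_notMem (by exact hQ), mul_zero]
    positivity

theorem mul_prG_le_sum_of_subset {n : ℕ} {p : ℝ} (h0 : 0 ≤ p) (h1 : p ≤ 1) {ι : Type*}
    (s : Finset ι) (Q : SimpleGraph (Fin n) → Prop) (R : ι → SimpleGraph (Fin n) → Prop) (c : ℝ)
    (h : ∀ G, Q G → ∃ s' ⊆ s, c ≤ (s'.card : ℝ) ∧ ∀ i ∈ s', R i G) :
    c * prG n p Q ≤ ∑ i ∈ s, prG n p (R i) := by
  classical
  refine mul_prG_le_sum h0 h1 s Q R c fun G hG => ?_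
  obtain ⟨s', hs, hc, hR⟩ := h G hG
  exact hc.trans (Nat.cast_le.2 (Finset.card_le_card fun i hi =>
    Finset.mem_filter.2 ⟨hs hi, hR i hi⟩))

theorem prG_exists_le {n : ℕ} {p : ℝ} (h0 : 0 ≤ p) (h1 : p ≤ 1) {ι : Type*} (s : Finset ι)
    (Q : SimpleGraph (Fin n) → Prop) (R : ι → SimpleGraph (Fin n) → Prop)
    (h : ∀ G, Q G → ∃ i ∈ s, R i G) :
    prG n p Q ≤ ∑ i ∈ s, prG n p (R i) := by
  classical
  rw [← one_mul (prG n p Q)]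
  refine mul_prG_le_sum h0 h1 s Q R 1 fun G hG => ?_
  obtain ⟨i, hi, hR⟩ := h G hG
  exact_mod_cast Finset.card_pos.2 ⟨i, Finset.mem_filter.2 ⟨hi, hR⟩⟩

theorem prG_mono {n : ℕ} {p : ℝ} (h0 : 0 ≤ p) (h1 : p ≤ 1)
    {Q R : SimpleGraph (Fin n) → Prop} (h : ∀ G, Q G → R G) : prG n p Q ≤ prG n p R := by
  simpa using prG_exists_le h0 h1 {()} Q (fun _ => R) fun G hG => ⟨(), by simp, h G hG⟩

theorem prG_or_le {n : ℕ} {p : ℝ} (h0 : 0 ≤ p) (h1 : p ≤ 1)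
    (Q R : SimpleGraph (Fin n) → Prop) :
    prG n p (fun G => Q G ∨ R G) ≤ prG n p Q + prG n p R := by
  have := prG_exists_le h0 h1 Finset.univ (fun G => Q G ∨ R G)
    (fun b : Bool => if b then Q else R) fun G hG => by
      rcases hG with hG | hG
      · exact ⟨true, by simp, by simpa using hG⟩
      · exact ⟨false, by simp, by simpa using hG⟩
  simpa using this

theorem prG_nonneg {n : ℕ} {p : ℝ} (h0 : 0 ≤ p) (h1 : p ≤ 1)
    (Q : SimpleGraph (Fin n) → Prop) : 0 ≤ prG n p Q :=
  Finset.sum_nonneg fun _ _ => Set.indicator_nonneg (fun _ _ =>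
    mul_nonneg (pow_nonneg h0 _) (pow_nonneg (by linarith) _)) _

/-- The probability that all edges in `F` are present and all edges in `H` are absent. -/
theorem prG_cylinder {n : ℕ} {p : ℝ} (F H : Finset (Sym2 (Fin n)))
    (hF : F ⊆ allEdges n) (hH : H ⊆ allEdges n) (hFH : Disjoint F H) :
    prG n p (fun G => (∀ e ∈ F, e ∈ G.edgeSet) ∧ ∀ e ∈ H, e ∉ G.edgeSet)
      = p ^ F.card * (1 - p) ^ H.card := by
  classical
  have key := Finset.prod_add (fun e => if e ∈ H then 0 else p)
    (fun e => if e ∈ F then 0 else 1 - p) (allEdges n)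
  have hl : ∏ e ∈ allEdges n, ((if e ∈ H then 0 else p) + (if e ∈ F then 0 else 1 - p))
      = p ^ F.card * (1 - p) ^ H.card := by
    have : ∀ e ∈ allEdges n, ((if e ∈ H then 0 else p) + (if e ∈ F then 0 else 1 - p))
        = (if e ∈ F then p else 1) * (if e ∈ H then 1 - p else 1) := by
      intro e _
      by_cases h1 : e ∈ F
      · have h2 : e ∉ H := Finset.disjoint_left.1 hFH h1
        simp [h1, h2]
      · by_cases h2 : e ∈ H <;> simp [h1, h2]
    rw [Finset.prod_congr rfl this, Finset.prod_mul_distrib, Finset.prod_ite_mem,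
      Finset.prod_ite_mem, Finset.inter_eq_right.2 hF, Finset.inter_eq_right.2 hH,
      Finset.prod_const, Finset.prod_const]
  rw [← hl, key]
  unfold prG
  refine Finset.sum_congr rfl fun S hS => ?_
  rw [Finset.mem_powerset] at hS
  have hedge : ∀ e ∈ allEdges n, (e ∈ (SimpleGraph.fromEdgeSet
      (S : Set (Sym2 (Fin n)))).edgeSet ↔ e ∈ S) := by
    intro e he
    have : ¬ e.IsDiag := (Finset.mem_filter.1 he).2
    simp [SimpleGraph.edgeSet_fromEdgeSet, this]
  by_cases hQ : (∀ e ∈ F, e ∈ (SimpleGraph.fromEdgeSet (S : Set (Sym2 (Fin n)))).edgeSet) ∧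
      ∀ e ∈ H, e ∉ (SimpleGraph.fromEdgeSet (S : Set (Sym2 (Fin n)))).edgeSet
  · rw [Set.indicator_of_mem (by exact hQ)]
    have e1 : ∏ e ∈ S, (if e ∈ H then 0 else p) = ∏ e ∈ S, p := by
      refine Finset.prod_congr rfl fun e he => if_neg fun heH => ?_
      exact hQ.2 e heH ((hedge e (hH heH)).2 he)
    have e2 : ∏ e ∈ allEdges n \ S, (if e ∈ F then 0 else 1 - p)
        = ∏ e ∈ allEdges n \ S, (1 - p) := by
      refine Finset.prod_congr rfl fun e he => if_neg fun heF => ?_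
      exact (Finset.mem_sdiff.1 he).2 ((hedge e (hF heF)).1 (hQ.1 e heF))
    rw [e1, e2, Finset.prod_const, Finset.prod_const, Finset.card_sdiff_of_subset hS]
  · rw [Set.indicator_of_notMem (by exact hQ)]
    rw [not_and_or] at hQ
    push Not at hQ
    symm
    rcases hQ with ⟨e, he, hne⟩ | ⟨e, he, hne⟩
    · rw [Finset.prod_eq_zero (s := allEdges n \ S) (i := e), mul_zero]
      · exact Finset.mem_sdiff.2 ⟨hF he, fun h => hne ((hedge e (hF he)).2 h)⟩
      · simp [he]
    · rw [Finset.prod_eq_zero (s := S) (i := e), zero_mul]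
      · exact (hedge e (hH he)).1 hne
      · simp [he]

section Elimination

variable {V : Type*}

theorem exists_min_touching {G : SimpleGraph V} {A : Finset V} {τ : V → ℕ} {x : V} (t : ℕ)
    (h : ∃ u ∈ A, τ u < t ∧ (x = u ∨ G.Adj u x)) :
    ∃ u ∈ A, τ u < t ∧ (x = u ∨ G.Adj u x) ∧
      ∀ u' ∈ A, τ u' < τ u → x ≠ u' ∧ ¬ G.Adj u' x := by
  classical
  obtain ⟨u₀, hu₀, ht₀, hx₀⟩ := h
  obtain ⟨u, hu, hmin⟩ := Finset.exists_min_image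
    (A.filter fun u => τ u < t ∧ (x = u ∨ G.Adj u x)) τ
    ⟨u₀, Finset.mem_filter.2 ⟨hu₀, ht₀, hx₀⟩⟩
  rw [Finset.mem_filter] at hu
  refine ⟨u, hu.1, hu.2.1, hu.2.2, fun u' hu' hlt => ?_⟩
  rw [← not_or]
  intro hx
  have := hmin u' (Finset.mem_filter.2 ⟨hu', hlt.trans hu.2.1, hx⟩)
  omega

variable [Fintype V]

open Classical in
/-- The neighbours of `w` that are neither in nor adjacent to the part of `A` preceding `w`. -/
noncomputable def newNbrs (G : SimpleGraph V) (A : Finset V) (τ : V → ℕ) (w : V) : Finset V :=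
  Finset.univ.filter fun x => G.Adj w x ∧ ∀ u ∈ A, τ u < τ w → x ≠ u ∧ ¬ G.Adj u x

theorem mem_newNbrs {G : SimpleGraph V} {A : Finset V} {τ : V → ℕ} {w x : V} :
    x ∈ newNbrs G A τ w ↔ G.Adj w x ∧ ∀ u ∈ A, τ u < τ w → x ≠ u ∧ ¬ G.Adj u x := by
  simp [newNbrs]

/-- A set `A`, ordered by `τ`, in which every vertex has at most three new neighbours. -/
structure IsElimination (G : SimpleGraph V) (A : Finset V) (τ : V → ℕ) : Prop where
  injOn : Set.InjOn τ A
  card_newNbrs_le : ∀ w ∈ A, (newNbrs G A τ w).card ≤ 3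

/-- `w` depends on `u` when the elimination of `u` may have cost `w` a neighbour. -/
def ElimDependsOn (G : SimpleGraph V) (A : Finset V) (τ : V → ℕ) (w u : V) : Prop :=
  u ∈ A ∧ τ u < τ w ∧ (w ∈ newNbrs G A τ u ∨ (∃ x ∈ newNbrs G A τ u, G.Adj w x) ∨
    (G.Adj w u ∧ ∃ k ∈ A, τ k < τ w ∧ w ∈ newNbrs G A τ k))

theorem IsElimination.exists_card_le {G : SimpleGraph V} :
    ∃ (A : Finset V) (τ : V → ℕ), IsElimination G A τ ∧
      ((Finset.univ : Finset V).card ≤ (strongCore G 4).ncard + 4 * A.card) := by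
  classical
  by_contra hcon
  push Not at hcon
  have hall : ∀ k, ∃ (A : Finset V) (τ : V → ℕ), IsElimination G A τ ∧ A.card = k ∧
      ∀ u ∈ A, τ u < k := by
    intro k
    induction k with
    | zero => exact ⟨∅, fun _ => 0, ⟨by simp, by simp⟩, by simp, by simp⟩
    | succ k ih =>
      obtain ⟨A, τ, hE, hk, hτ⟩ := ih
      let S : Finset V := Finset.univ.filter fun x => ∀ u ∈ A, x ≠ u ∧ ¬ G.Adj u x
      have hmemS : ∀ x, x ∈ S ↔ ∀ u ∈ A, x ≠ u ∧ ¬ G.Adj u x := fun x => by simp [S]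
      have hcover : (Finset.univ : Finset V) ⊆ S ∪ (A ∪ A.biUnion (newNbrs G A τ)) := by
        intro x _
        by_cases hx : x ∈ S
        · exact Finset.mem_union_left _ hx
        refine Finset.mem_union_right _ ?_
        by_cases hxA : x ∈ A
        · exact Finset.mem_union_left _ hxA
        refine Finset.mem_union_right _ ?_
        rw [hmemS] at hx
        push Not at hx
        obtain ⟨u, hu, hux⟩ := hx
        have hne : ∀ u ∈ A, x ≠ u := fun u hu h => hxA (h ▸ hu)
        obtain ⟨u, hu, _, hux, hmin⟩ := exists_min_touching (G := G) (x := x) k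
          ⟨u, hu, hτ u hu, Or.inr (hux (hne u hu))⟩
        exact Finset.mem_biUnion.2 ⟨u, hu, mem_newNbrs.2
          ⟨hux.resolve_left (hne u hu), hmin⟩⟩
      have hcard : (Finset.univ : Finset V).card ≤ S.card + 4 * A.card := by
        refine (Finset.card_le_card hcover).trans ((Finset.card_union_le _ _).trans ?_)
        have h1 := Finset.card_union_le A (A.biUnion (newNbrs G A τ))
        have h2 := Finset.card_biUnion_le_card_mul A (newNbrs G A τ) 3 hE.card_newNbrs_le
        omega
      have hns : ¬ IsStrongSet G 4 (S : Set V) := by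
        intro hs
        have hsub : (S : Set V) ⊆ strongCore G 4 := Set.subset_sUnion_of_mem hs
        have := Set.ncard_le_ncard hsub (Set.toFinite _)
        rw [Set.ncard_coe_finset] at this
        have := hcon A τ hE
        omega
      unfold IsStrongSet at hns
      push Not at hns
      obtain ⟨v, hv, hv4⟩ := hns
      have hvA : v ∉ A := by
        intro hvA
        rcases hv with hv | ⟨s, hs, hvs⟩
        · exact ((hmemS v).1 hv v hvA).1 rfl
        · exact ((hmemS s).1 hs v hvA).2 hvs
      have hτ' : ∀ u ∈ A, Function.update τ v k u = τ u := fun u hu =>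
        Function.update_of_ne (by rintro rfl; exact hvA hu) _ _
      have hold : ∀ w ∈ A, newNbrs G (insert v A) (Function.update τ v k) w
          = newNbrs G A τ w := by
        intro w hw
        ext x
        rw [mem_newNbrs, mem_newNbrs, hτ' w hw, Finset.forall_mem_insert,
          Function.update_self]
        refine and_congr_right fun _ => ⟨fun h u hu => ?_, fun h => ⟨fun h' => ?_, fun u hu => ?_⟩⟩
        · have := h.2 u hu
          rwa [hτ' u hu] at this
        · have := hτ w hw
          omega
        · rw [hτ' u hu]
          exact h u hu
      have hnew : (newNbrs G (insert v A) (Function.update τ v k) v : Set V)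
          ⊆ {u | u ∈ (S : Set V) ∧ G.Adj v u} := by
        intro x hx
        rw [Finset.mem_coe, mem_newNbrs, Function.update_self] at hx
        refine ⟨(hmemS x).2 fun u hu => hx.2 u (Finset.mem_insert_of_mem hu) ?_, hx.1⟩
        rw [hτ' u hu]
        exact hτ u hu
      refine ⟨insert v A, Function.update τ v k, ⟨?_, ?_⟩, ?_, ?_⟩
      · intro a ha b hb hab
        rw [Finset.mem_coe, Finset.mem_insert] at ha hb
        rcases ha with rfl | ha <;> rcases hb with rfl | hb
        · rfl
        · rw [Function.update_self, hτ' b hb] at hab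
          have := hτ b hb
          omega
        · rw [Function.update_self, hτ' a ha] at hab
          have := hτ a ha
          omega
        · rw [hτ' a ha, hτ' b hb] at hab
          exact hE.injOn ha hb hab
      · intro w hw
        rw [Finset.mem_insert] at hw
        rcases hw with rfl | hw
        · have := Set.ncard_le_ncard hnew (Set.toFinite _)
          rw [Set.ncard_coe_finset] at this
          omega
        · rw [hold w hw]
          exact hE.card_newNbrs_le w hw
      · rw [Finset.card_insert_of_notMem hvA, hk]
      · intro u hu
        rw [Finset.mem_insert] at hu
        rcases hu with rfl | hu
        · simp
        · rw [hτ' u hu]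
          have := hτ u hu
          omega
  obtain ⟨A, τ, _, hA, _⟩ := hall (Fintype.card V + 1)
  have := Finset.card_le_univ A
  omega

theorem disjoint_newNbrs {G : SimpleGraph V} {A : Finset V} {τ : V → ℕ}
    (hinj : Set.InjOn τ A) {u v x : V} (hu : u ∈ A) (hv : v ∈ A)
    (hxu : x ∈ newNbrs G A τ u) (hxv : x ∈ newNbrs G A τ v) : u = v := by
  rw [mem_newNbrs] at hxu hxv
  rcases lt_trichotomy (τ u) (τ v) with h | h | h
  · exact absurd hxu.1 (hxv.2 u hu h).2
  · exact hinj hu hv h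
  · exact absurd hxv.1 (hxu.2 v hv h).2

/-- All neighbours of `w` are new neighbours of `w` or are accounted for by the vertices
on which `w` depends. -/
theorem adj_cases {G : SimpleGraph V} {A : Finset V} {τ : V → ℕ} {w x : V}
    (hwx : G.Adj w x) :
    x ∈ newNbrs G A τ w ∨ ∃ u, ElimDependsOn G A τ w u ∧ (x = u ∨ x ∈ newNbrs G A τ u) := by
  by_cases hx : x ∈ newNbrs G A τ w
  · exact Or.inl hx
  right
  have hex : ∃ u ∈ A, τ u < τ w ∧ (x = u ∨ G.Adj u x) := by
    rw [mem_newNbrs] at hx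
    push Not at hx
    obtain ⟨u, hu, hlt, h⟩ := hx hwx
    exact ⟨u, hu, hlt, or_iff_not_imp_left.2 h⟩
  obtain ⟨u, hu, hlt, hxu, hmin⟩ := exists_min_touching (τ w) hex
  rcases hxu with rfl | hxu
  · refine ⟨x, ⟨hu, hlt, ?_⟩, Or.inl rfl⟩
    by_cases hw : w ∈ newNbrs G A τ x
    · exact Or.inl hw
    right; right
    refine ⟨hwx, ?_⟩
    have hex' : ∃ u ∈ A, τ u < τ w ∧ (w = u ∨ G.Adj u w) := ⟨x, hu, hlt, Or.inr hwx.symm⟩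
    obtain ⟨k, hk, hklt, hkw, hkmin⟩ := exists_min_touching (τ w) hex'
    refine ⟨k, hk, hklt, mem_newNbrs.2 ⟨hkw.resolve_left ?_, hkmin⟩⟩
    rintro rfl
    exact lt_irrefl _ hklt
  · have hxT : x ∈ newNbrs G A τ u := mem_newNbrs.2 ⟨hxu, hmin⟩
    exact ⟨u, ⟨hu, hlt, Or.inr (Or.inl ⟨x, hxT, hwx⟩)⟩, Or.inr hxT⟩

end Elimination

section Certificate

open Classical in
/-- The elements of `P \ J` whose assigned set avoids `P`. -/
noncomputable def freeVerts {V : Type*} (J P : Finset V) (T : V → Finset V) : Finset V :=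
  (P \ J).filter fun u => Disjoint (T u) P

open Classical in
/-- The pairs that can witness that some element of `P` depends on `u`. -/
noncomputable def linkSet {V : Type*} (P : Finset V) (T : V → Finset V) (u : V) :
    Finset (V × V) :=
  P ×ˢ T u ∪ (P ∩ P.biUnion T) ×ˢ {u}

open Classical in
/-- The assignments of at most three vertices to each element of `P`. -/
noncomputable def certSets {V : Type*} [Fintype V] (P : Finset V) : Finset (V → Finset V) :=
  Fintype.piFinset fun v => if v ∈ P then Finset.univ.filter fun S => S.card ≤ 3 else {∅}

open Classical in
/-- The choices of a link for each free vertex. -/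
noncomputable def certLinks {V : Type*} [Fintype V] (J P : Finset V) (T : V → Finset V) :
    Finset (V → V × V) :=
  Fintype.piFinset fun u => if u ∈ freeVerts J P T then linkSet P T u else {(u, u)}

open Classical in
/-- The edges that a certificate requires to be present. -/
noncomputable def certEdges {V : Type*} (J P : Finset V) (T : V → Finset V)
    (l : V → V × V) : Finset (Sym2 V) :=
  (P.sigma T).image (fun z => s(z.1, z.2)) ∪
    (freeVerts J P T).image fun u => s((l u).1, (l u).2)

open Classical in
/-- The pairs that a certificate requires to be absent. -/
noncomputable def certNonEdges {V : Type*} [Fintype V] (P : Finset V) (T : V → Finset V) :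
    Finset (Sym2 V) :=
  (P ×ˢ (Finset.univ \ (P ∪ P.biUnion T))).image fun z => s(z.1, z.2)

/-- `G` admits a certificate that `P` is the set of vertices on which `J` depends. -/
def HasCert {V : Type*} [Fintype V] (G : SimpleGraph V) (J P : Finset V) : Prop :=
  ∃ T ∈ certSets P, ∃ l ∈ certLinks J P T,
    (certEdges J P T l).card = ∑ v ∈ P, (T v).card + (freeVerts J P T).card ∧
    (∀ e ∈ certEdges J P T l, e ∈ G.edgeSet) ∧ ∀ e ∈ certNonEdges P T, e ∉ G.edgeSet

open Classical in
/-- The vertices on which some element of `J` depends, possibly indirectly. -/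
noncomputable def elimPast {V : Type*} [Fintype V] (G : SimpleGraph V) (A : Finset V)
    (τ : V → ℕ) (J : Finset V) : Finset V :=
  A.filter fun u => ∃ v ∈ J, Relation.ReflTransGen (ElimDependsOn G A τ) v u

variable {V : Type*} [Fintype V] {G : SimpleGraph V} {A : Finset V} {τ : V → ℕ}

theorem mem_elimPast {J : Finset V} {u : V} : u ∈ elimPast G A τ J ↔
    u ∈ A ∧ ∃ v ∈ J, Relation.ReflTransGen (ElimDependsOn G A τ) v u := by
  simp [elimPast]

theorem subset_elimPast {J : Finset V} (hJ : J ⊆ A) : J ⊆ elimPast G A τ J := fun v hv =>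
  mem_elimPast.2 ⟨hJ hv, v, hv, Relation.ReflTransGen.refl⟩

theorem elimPast_closed {J : Finset V} {w u : V} (hw : w ∈ elimPast G A τ J)
    (h : ElimDependsOn G A τ w u) : u ∈ elimPast G A τ J := by
  obtain ⟨_, v, hv, hvw⟩ := mem_elimPast.1 hw
  exact mem_elimPast.2 ⟨h.1, v, hv, hvw.tail h⟩

theorem exists_dependsOn_of_mem_elimPast {J : Finset V} (hJ : J ⊆ A) {u : V}
    (hu : u ∈ elimPast G A τ J) (huJ : u ∉ J) :
    ∃ w ∈ elimPast G A τ J, ElimDependsOn G A τ w u := by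
  obtain ⟨_, v, hv, hvu⟩ := mem_elimPast.1 hu
  rcases Relation.ReflTransGen.cases_tail hvu with rfl | ⟨w, hvw, hwu⟩
  · exact absurd hv huJ
  refine ⟨w, mem_elimPast.2 ⟨?_, v, hv, hvw⟩, hwu⟩
  rcases Relation.ReflTransGen.cases_tail hvw with rfl | ⟨_, _, h⟩
  · exact hJ hv
  · exact h.1

theorem hasCert_elimPast {J : Finset V} (hE : IsElimination G A τ) (hJ : J ⊆ A) :
    HasCert G J (elimPast G A τ J) := by
  classical
  set P := elimPast G A τ J with hP
  have hPA : P ⊆ A := fun u hu => (mem_elimPast.1 hu).1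
  let T : V → Finset V := fun v => if v ∈ P then newNbrs G A τ v else ∅
  have hT : ∀ v ∈ P, T v = newNbrs G A τ v := fun v hv => if_pos hv
  have hdisj : ∀ u ∈ P, ∀ v ∈ P, ∀ x, x ∈ T u → x ∈ T v → u = v := by
    intro u hu v hv x hxu hxv
    rw [hT u hu] at hxu
    rw [hT v hv] at hxv
    exact disjoint_newNbrs hE.injOn (hPA hu) (hPA hv) hxu hxv
  have hlater : ∀ u ∈ P, ∀ v ∈ P, τ u < τ v → u ∉ T v := by
    intro u hu v hv huv h
    rw [hT v hv, mem_newNbrs] at h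
    exact (h.2 u (hPA hu) huv).1 rfl
  have hadj : ∀ v ∈ P, ∀ x ∈ T v, G.Adj v x := by
    intro v hv x hx
    rw [hT v hv, mem_newNbrs] at hx
    exact hx.1
  have hfree : ∀ u, u ∈ freeVerts J P T ↔ u ∈ P ∧ u ∉ J ∧ Disjoint (T u) P := by
    intro u
    simp [freeVerts, and_assoc]
  have hlink : ∀ u ∈ freeVerts J P T, ∃ z : V × V, z.1 ∈ P ∧ τ u < τ z.1 ∧
      G.Adj z.1 z.2 ∧ (z.2 ∈ T u ∨ (z.2 = u ∧ z.1 ∈ P.biUnion T)) := by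
    intro u hu
    rw [hfree] at hu
    obtain ⟨w, hw, hwu⟩ := exists_dependsOn_of_mem_elimPast hJ hu.1 hu.2.1
    have hTu := hT u hu.1
    obtain ⟨_, hlt, h | ⟨x, hx, hwx⟩ | ⟨hwu', k, hk, hkw, hwk⟩⟩ := hwu
    · rw [← hTu] at h
      exact absurd hw (Finset.disjoint_left.1 hu.2.2 h)
    · exact ⟨(w, x), hw, hlt, hwx, Or.inl (hTu ▸ hx)⟩
    · have hkP : k ∈ P := elimPast_closed hw ⟨hk, hkw, Or.inl hwk⟩
      exact ⟨(w, u), hw, hlt, hwu', Or.inr ⟨rfl, Finset.mem_biUnion.2 ⟨k, hkP, by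
        rwa [hT k hkP]⟩⟩⟩
  choose! l hl using hlink
  let l' : V → V × V := fun u => if u ∈ freeVerts J P T then l u else (u, u)
  have hl' : ∀ u ∈ freeVerts J P T, l' u = l u := fun u hu => if_pos hu
  refine ⟨T, ?_, l', ?_, ?_, ?_, ?_⟩
  · rw [certSets, Fintype.mem_piFinset]
    intro v
    by_cases hv : v ∈ P
    · rw [if_pos hv, Finset.mem_filter, hT v hv]
      exact ⟨Finset.mem_univ _, hE.card_newNbrs_le v (hPA hv)⟩
    · rw [if_neg hv, Finset.mem_singleton]
      exact if_neg hv
  · rw [certLinks, Fintype.mem_piFinset]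
    intro u
    by_cases hu : u ∈ freeVerts J P T
    · rw [if_pos hu, hl' u hu, linkSet, Finset.mem_union, Finset.mem_product,
        Finset.mem_product, Finset.mem_inter, Finset.mem_singleton]
      obtain ⟨h1, _, _, h2 | ⟨h2, h3⟩⟩ := hl u hu
      · exact Or.inl ⟨h1, h2⟩
      · exact Or.inr ⟨⟨h1, h3⟩, h2⟩
    · rw [if_neg hu, Finset.mem_singleton]
      exact if_neg hu
  · have hP2 : ∀ u ∈ freeVerts J P T, u ∈ P := fun u hu => ((hfree u).1 hu).1
    have havoid : ∀ u ∈ freeVerts J P T, ∀ x ∈ T u, x ∉ P := fun u hu x hx =>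
      Finset.disjoint_left.1 ((hfree u).1 hu).2.2 hx
    rw [certEdges, Finset.card_union_of_disjoint, Finset.card_image_of_injOn,
      Finset.card_image_of_injOn, Finset.card_sigma]
    · intro u hu u' hu' heq
      simp only [Finset.mem_coe] at hu hu'
      simp only [hl' u hu, hl' u' hu'] at heq
      obtain ⟨h1, h2, _, h3⟩ := hl u hu
      obtain ⟨h1', h2', _, h3'⟩ := hl u' hu'
      rw [Sym2.eq_iff] at heq
      rcases h3 with h3 | ⟨h3, _⟩ <;> rcases h3' with h3' | ⟨h3', _⟩
      · rcases heq with ⟨e1, e2⟩ | ⟨e1, e2⟩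
        · exact hdisj u (hP2 u hu) u' (hP2 u' hu') _ h3 (e2 ▸ h3')
        · exact absurd (e2 ▸ h1') (havoid u hu _ h3)
      · rcases heq with ⟨e1, e2⟩ | ⟨e1, e2⟩
        · exact absurd (by rw [e2, h3']; exact hP2 u' hu') (havoid u hu _ h3)
        · exact absurd (e2 ▸ h1') (havoid u hu _ h3)
      · rcases heq with ⟨e1, e2⟩ | ⟨e1, e2⟩
        · exact absurd (by rw [← e2, h3]; exact hP2 u hu) (havoid u' hu' _ h3')
        · exact absurd (e1 ▸ h1) (havoid u' hu' _ h3')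
      · rcases heq with ⟨e1, e2⟩ | ⟨e1, e2⟩
        · rw [← h3, ← h3', e2]
        · rw [h3'] at e1
          rw [h3] at e2
          rw [e1] at h2
          rw [← e2] at h2'
          exact absurd h2 (lt_asymm h2')
    · rintro ⟨v, x⟩ hv ⟨v', x'⟩ hv' heq
      simp only [Finset.mem_coe, Finset.mem_sigma] at hv hv'
      rw [Sym2.eq_iff] at heq
      rcases heq with ⟨e1, e2⟩ | ⟨e1, e2⟩
      · simp only at e1 e2
        subst e1 e2
        rfl
      · simp only at e1 e2
        subst e1 e2
        exfalso
        rcases lt_trichotomy (τ v) (τ x) with h | h | h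
        · exact hlater v hv.1 x hv'.1 h hv'.2
        · have := hE.injOn (hPA hv.1) (hPA hv'.1) h
          subst this
          exact G.loopless.irrefl _ (hadj v hv.1 _ hv.2)
        · exact hlater x hv'.1 v hv.1 h hv.2
    · rw [Finset.disjoint_left]
      intro e he he'
      rw [Finset.mem_image] at he he'
      obtain ⟨⟨v, x⟩, hv, rfl⟩ := he
      obtain ⟨u, hu, heq⟩ := he'
      rw [Finset.mem_sigma] at hv
      simp only at hv
      rw [hl' u hu] at heq
      obtain ⟨h1, h2, _, h3⟩ := hl u hu
      rw [Sym2.eq_iff] at heq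
      rcases h3 with h3 | ⟨h3, _⟩ <;> rcases heq with ⟨e1, e2⟩ | ⟨e1, e2⟩
      · rw [e2] at h3
        have := hdisj u (hP2 u hu) v hv.1 x h3 hv.2
        rw [e1, this] at h2
        exact lt_irrefl _ h2
      · exact havoid u hu _ h3 (e2 ▸ hv.1)
      · rw [h3] at e2
        rw [e1] at h2
        exact hlater u (hP2 u hu) v hv.1 h2 (e2 ▸ hv.2)
      · rw [h3] at e2
        subst e2
        rw [e1] at h1
        exact havoid u hu x hv.2 h1
  · intro e he
    rw [certEdges, Finset.mem_union, Finset.mem_image, Finset.mem_image] at he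
    rcases he with ⟨z, hz, rfl⟩ | ⟨u, hu, rfl⟩
    · rw [Finset.mem_sigma] at hz
      exact hadj _ hz.1 _ hz.2
    · rw [hl' u hu]
      exact (hl u hu).2.2.1
  · intro e he hG
    rw [certNonEdges, Finset.mem_image] at he
    obtain ⟨⟨v, x⟩, hz, rfl⟩ := he
    rw [Finset.mem_product, Finset.mem_sdiff, Finset.mem_union, not_or] at hz
    obtain ⟨hv, _, hxP, hxT⟩ := hz
    simp only at hv hxP hxT hG
    rw [SimpleGraph.mem_edgeSet] at hG
    rcases adj_cases (A := A) (τ := τ) hG with h | ⟨u, hu, rfl | h⟩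
    · exact hxT (Finset.mem_biUnion.2 ⟨v, hv, by rwa [hT v hv]⟩)
    · exact hxP (elimPast_closed hv hu)
    · have huP := elimPast_closed hv hu
      exact hxT (Finset.mem_biUnion.2 ⟨u, huP, by rwa [hT u huP]⟩)

end Certificate

/-- The exponential series truncated after the term of degree `k`. -/
noncomputable def expTrunc (k : ℕ) (x : ℝ) : ℝ := ∑ i ∈ Finset.range (k + 1), x ^ i / i.factorial

theorem expTrunc_nonneg (k : ℕ) {x : ℝ} (hx : 0 ≤ x) : 0 ≤ expTrunc k x :=
  Finset.sum_nonneg fun _ _ => by positivity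

section SubsetSums

variable {V : Type*}

open Classical in
/-- The weight of a set of new neighbours in the union bound over certificates. -/
noncomputable def certWeight (P : Finset V) (θ : ℝ) (S : Finset V) : ℝ :=
  Real.exp ((S ∩ P).card / 3) * if Disjoint S P then 1 else θ

open Classical in
theorem certWeight_le (P : Finset V) {θ : ℝ} (hθ : 0 ≤ θ) {S : Finset V} (hS : S.card ≤ 3) :
    certWeight P θ S ≤ 1 + Real.exp (1 / 3) * θ * (∑ c ∈ P, if {c} ⊆ S then 1 else 0)
      + Real.exp 1 * θ * (∑ C ∈ P.powersetCard 2, if C ⊆ S then 1 else 0) := by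
  have h1 : 0 ≤ Real.exp (1 / 3) * θ := by positivity
  have h2 : 0 ≤ Real.exp 1 * θ := by positivity
  have n1 : (0 : ℝ) ≤ ∑ c ∈ P, if {c} ⊆ S then 1 else 0 :=
    Finset.sum_nonneg fun _ _ => by split_ifs <;> norm_num
  have n2 : (0 : ℝ) ≤ ∑ C ∈ P.powersetCard 2, if C ⊆ S then 1 else 0 :=
    Finset.sum_nonneg fun _ _ => by split_ifs <;> norm_num
  have m1 := mul_nonneg h1 n1
  have m2 := mul_nonneg h2 n2
  unfold certWeight
  by_cases hd : Disjoint S P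
  · rw [if_pos hd, Finset.disjoint_iff_inter_eq_empty.1 hd]
    simp only [Finset.card_empty, Nat.cast_zero, zero_div, Real.exp_zero, mul_one]
    linarith
  rw [if_neg hd]
  have hne : (S ∩ P).Nonempty := Finset.not_disjoint_iff_nonempty_inter.1 hd
  by_cases hc : (S ∩ P).card = 1
  · obtain ⟨c, hcm⟩ := hne
    rw [Finset.mem_inter] at hcm
    have : (1 : ℝ) ≤ ∑ c ∈ P, if {c} ⊆ S then 1 else 0 := by
      refine le_trans (le_of_eq ?_) (Finset.single_le_sum (a := c) (fun _ _ => ?_) hcm.2)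
      · rw [if_pos (Finset.singleton_subset_iff.2 hcm.1)]
      · split_ifs <;> norm_num
    have := mul_le_mul_of_nonneg_left this h1
    rw [hc]
    norm_num at *
    linarith
  · have hc2 : 2 ≤ (S ∩ P).card := by
      have := hne.card_pos
      omega
    have hc3 : (S ∩ P).card ≤ 3 := (Finset.card_le_card Finset.inter_subset_left).trans hS
    obtain ⟨C, hC, hC2⟩ := Finset.exists_subset_card_eq hc2
    have : (1 : ℝ) ≤ ∑ C ∈ P.powersetCard 2, if C ⊆ S then 1 else 0 := by
      refine le_trans (le_of_eq ?_) (Finset.single_le_sum (a := C) (fun _ _ => ?_)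
        (Finset.mem_powersetCard.2 ⟨hC.trans Finset.inter_subset_right, hC2⟩))
      · rw [if_pos (hC.trans Finset.inter_subset_left)]
      · split_ifs <;> norm_num
    have := mul_le_mul_of_nonneg_left this h2
    have he : Real.exp ((S ∩ P).card / 3) ≤ Real.exp 1 := by
      rw [Real.exp_le_exp]
      have : ((S ∩ P).card : ℝ) ≤ 3 := by exact_mod_cast hc3
      linarith
    have := mul_le_mul_of_nonneg_right he hθ
    linarith

variable [Fintype V]

open Classical in
theorem sum_pow_card_le {p : ℝ} (hp : 0 ≤ p) (k : ℕ) :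
    ∑ S ∈ (Finset.univ : Finset (Finset V)).filter (fun S => S.card ≤ k), p ^ S.card
      ≤ expTrunc k (Fintype.card V * p) := by
  rw [expTrunc, ← Finset.sum_fiberwise_of_maps_to (t := Finset.range (k + 1))
    (g := fun S : Finset V => S.card)]
  · refine Finset.sum_le_sum fun i _ => ?_
    have hsub : ((Finset.univ : Finset (Finset V)).filter (fun S => S.card ≤ k)).filter
        (fun S => S.card = i) ⊆ Finset.powersetCard i Finset.univ := by
      intro S hS
      rw [Finset.mem_filter] at hS
      exact Finset.mem_powersetCard.2 ⟨Finset.subset_univ _, hS.2⟩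
    calc _ ≤ ∑ S ∈ Finset.powersetCard i (Finset.univ : Finset V), p ^ S.card :=
          Finset.sum_le_sum_of_subset_of_nonneg hsub fun _ _ _ => by positivity
      _ = ((Fintype.card V).choose i : ℝ) * p ^ i := by
          rw [Finset.sum_congr rfl fun S hS => by rw [(Finset.mem_powersetCard.1 hS).2],
            Finset.sum_const, Finset.card_powersetCard, nsmul_eq_mul, Finset.card_univ]
      _ ≤ ((Fintype.card V : ℝ) ^ i / i.factorial) * p ^ i :=
          mul_le_mul_of_nonneg_right (Nat.choose_le_pow_div _ _) (by positivity)
      _ = _ := by rw [mul_pow]; ring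
  · intro S hS
    rw [Finset.mem_filter] at hS
    rw [Finset.mem_range]
    omega

open Classical in
theorem sum_pow_card_superset_le {p : ℝ} (hp : 0 ≤ p) (k : ℕ) (C : Finset V) :
    ∑ S ∈ ((Finset.univ : Finset (Finset V)).filter (fun S => S.card ≤ k + C.card)).filter
      (fun S => C ⊆ S), p ^ S.card ≤ p ^ C.card * expTrunc k (Fintype.card V * p) := by
  refine le_trans ?_ (mul_le_mul_of_nonneg_left (sum_pow_card_le (V := V) hp k) (by positivity))
  rw [Finset.mul_sum]
  have : ∀ S ∈ ((Finset.univ : Finset (Finset V)).filter (fun S => S.card ≤ k + C.card)).filter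
      (fun S => C ⊆ S), p ^ S.card = p ^ C.card * p ^ (S \ C).card := by
    intro S hS
    have hC := (Finset.mem_filter.1 hS).2
    rw [← pow_add, add_comm, Finset.card_sdiff_add_card_eq_card hC]
  rw [Finset.sum_congr rfl this]
  refine le_trans (le_of_eq ?_) (Finset.sum_le_sum_of_subset_of_nonneg (s :=
    (((Finset.univ : Finset (Finset V)).filter (fun S => S.card ≤ k + C.card)).filter
      (fun S => C ⊆ S)).image (fun S => S \ C)) (f := fun S => p ^ C.card * p ^ S.card) ?_
    fun _ _ _ => by positivity)
  · rw [Finset.sum_image]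
    intro S hS S' hS' heq
    rw [Finset.mem_coe, Finset.mem_filter] at hS hS'
    simp only at heq
    rw [← Finset.sdiff_union_of_subset hS.2, heq, Finset.sdiff_union_of_subset hS'.2]
  · intro S' hS'
    rw [Finset.mem_image] at hS'
    obtain ⟨S, hS, rfl⟩ := hS'
    rw [Finset.mem_filter, Finset.mem_filter] at hS
    rw [Finset.mem_filter]
    refine ⟨Finset.mem_univ _, ?_⟩
    rw [Finset.card_sdiff_of_subset hS.2]
    omega

open Classical in
theorem sum_certWeight_le {p θ : ℝ} (hp : 0 ≤ p) (hθ : 0 ≤ θ) (P : Finset V) :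
    ∑ S ∈ (Finset.univ : Finset (Finset V)).filter (fun S => S.card ≤ 3),
      p ^ S.card * certWeight P θ S ≤ expTrunc 3 (Fintype.card V * p)
        + Real.exp (1 / 3) * θ * (P.card * p) * expTrunc 2 (Fintype.card V * p)
        + Real.exp 1 * θ * (P.card * p) ^ 2 * expTrunc 1 (Fintype.card V * p) := by
  set F := (Finset.univ : Finset (Finset V)).filter (fun S => S.card ≤ 3) with hF
  calc _ ≤ ∑ S ∈ F, (p ^ S.card + Real.exp (1 / 3) * θ *
          (∑ c ∈ P, if {c} ⊆ S then p ^ S.card else 0)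
          + Real.exp 1 * θ * (∑ C ∈ P.powersetCard 2, if C ⊆ S then p ^ S.card else 0)) := by
        refine Finset.sum_le_sum fun S hS => ?_
        have h := mul_le_mul_of_nonneg_left
          (certWeight_le P hθ (Finset.mem_filter.1 hS).2) (pow_nonneg hp S.card)
        refine h.trans (le_of_eq ?_)
        have e1 : ∀ C : Finset V, (if C ⊆ S then p ^ S.card else 0)
            = p ^ S.card * (if C ⊆ S then 1 else 0) := fun C => by split_ifs <;> simp
        simp only [e1, ← Finset.mul_sum]
        ring
    _ = ∑ S ∈ F, p ^ S.card + Real.exp (1 / 3) * θ *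
          (∑ c ∈ P, ∑ S ∈ F.filter (fun S => {c} ⊆ S), p ^ S.card)
          + Real.exp 1 * θ * (∑ C ∈ P.powersetCard 2,
            ∑ S ∈ F.filter (fun S => C ⊆ S), p ^ S.card) := by
        rw [Finset.sum_add_distrib, Finset.sum_add_distrib, ← Finset.mul_sum, ← Finset.mul_sum,
          Finset.sum_comm, Finset.sum_comm (t := P.powersetCard 2)]
        simp only [Finset.sum_filter]
    _ ≤ expTrunc 3 (Fintype.card V * p) + Real.exp (1 / 3) * θ *
          (∑ c ∈ P, p * expTrunc 2 (Fintype.card V * p))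
          + Real.exp 1 * θ * (∑ C ∈ P.powersetCard 2,
            p ^ 2 * expTrunc 1 (Fintype.card V * p)) := by
        gcongr with c hc C hC
        · exact sum_pow_card_le hp 3
        · simpa using sum_pow_card_superset_le hp 2 {c}
        · have := sum_pow_card_superset_le hp 1 C
          rwa [(Finset.mem_powersetCard.1 hC).2] at this
    _ ≤ _ := by
        rw [Finset.sum_const, Finset.sum_const, Finset.card_powersetCard, nsmul_eq_mul,
          nsmul_eq_mul]
        have hch : (P.card.choose 2 : ℝ) ≤ (P.card : ℝ) ^ 2 := by
          exact_mod_cast Nat.choose_le_pow P.card 2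
        have := mul_le_mul_of_nonneg_right hch (mul_nonneg (sq_nonneg p)
          (expTrunc_nonneg 1 (mul_nonneg (Nat.cast_nonneg (Fintype.card V)) hp)))
        have := mul_le_mul_of_nonneg_left this (show 0 ≤ Real.exp 1 * θ by positivity)
        linarith

end SubsetSums

theorem exists_of_mem_certNonEdges {V : Type*} [Fintype V] {P : Finset V} {T : V → Finset V}
    {e : Sym2 V} (he : e ∈ certNonEdges P T) : ∃ v ∈ P, ∃ x, x ∉ P ∧ s(v, x) = e := by
  classical
  rw [certNonEdges, Finset.mem_image] at he
  obtain ⟨z, hz, rfl⟩ := he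
  rw [Finset.mem_product, Finset.mem_sdiff, Finset.mem_union, not_or] at hz
  exact ⟨z.1, hz.1, z.2, hz.2.2.1, rfl⟩

theorem certNonEdges_card {V : Type*} [Fintype V] {P : Finset V} {T : V → Finset V}
    (hT : T ∈ certSets P) :
    P.card * (Fintype.card V - 4 * P.card) ≤ (certNonEdges P T).card := by
  classical
  rw [certNonEdges, Finset.card_image_of_injOn]
  · rw [Finset.card_product]
    refine Nat.mul_le_mul_left _ ?_
    rw [Finset.card_sdiff_of_subset (Finset.subset_univ _), Finset.card_univ]
    have h1 := Finset.card_union_le P (P.biUnion T)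
    have h2 := Finset.card_biUnion_le_card_mul P T 3 fun v hv => by
      have := Fintype.mem_piFinset.1 hT v
      rw [if_pos hv, Finset.mem_filter] at this
      exact this.2
    have h3 : (P ∪ P.biUnion T).card ≤ 4 * P.card := by omega
    convert Nat.sub_le_sub_left h3 (Fintype.card V) using 3
  · rintro ⟨v, x⟩ hz ⟨v', x'⟩ hz' heq
    simp only [Finset.coe_product, Set.mem_prod, Finset.mem_coe, Finset.mem_sdiff,
      Finset.mem_union, not_or] at hz hz'
    rw [Sym2.eq_iff] at heq
    rcases heq with ⟨e1, e2⟩ | ⟨e1, e2⟩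
    · exact Prod.ext e1 e2
    · rw [show v = x' from e1] at hz
      exact absurd hz.1 hz'.2.2.1

theorem disjoint_certEdges_certNonEdges {V : Type*} [Fintype V] {J P : Finset V}
    {T : V → Finset V} {l : V → V × V} (hl : l ∈ certLinks J P T) :
    Disjoint (certEdges J P T l) (certNonEdges P T) := by
  classical
  have hin : ∀ e ∈ certEdges J P T l, ∀ x ∈ e, x ∈ P ∪ P.biUnion T := by
    intro e he x hx
    rw [certEdges, Finset.mem_union, Finset.mem_image, Finset.mem_image] at he
    rcases he with ⟨z, hz, rfl⟩ | ⟨u, hu, rfl⟩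
    · rw [Finset.mem_sigma] at hz
      rcases Sym2.mem_iff.1 hx with rfl | rfl
      · exact Finset.mem_union_left _ hz.1
      · exact Finset.mem_union_right _ (Finset.mem_biUnion.2 ⟨_, hz.1, hz.2⟩)
    · have huP : u ∈ P := (Finset.mem_sdiff.1 (Finset.mem_filter.1 hu).1).1
      have hlu := Fintype.mem_piFinset.1 hl u
      rw [if_pos hu, linkSet, Finset.mem_union, Finset.mem_product, Finset.mem_product,
        Finset.mem_inter, Finset.mem_singleton] at hlu
      rcases Sym2.mem_iff.1 hx with rfl | rfl
      · rcases hlu with hlu | hlu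
        · exact Finset.mem_union_left _ hlu.1
        · exact Finset.mem_union_left _ hlu.1.1
      · rcases hlu with hlu | hlu
        · exact Finset.mem_union_right _ (Finset.mem_biUnion.2 ⟨u, huP, hlu.2⟩)
        · rw [hlu.2]
          exact Finset.mem_union_left _ huP
  rw [Finset.disjoint_left]
  intro e he he'
  rw [certNonEdges, Finset.mem_image] at he'
  obtain ⟨z, hz, rfl⟩ := he'
  rw [Finset.mem_product, Finset.mem_sdiff] at hz
  exact hz.2.2 (hin _ he _ (Sym2.mem_mk_right _ _))

theorem certLinks_card_le {V : Type*} [Fintype V] {J P : Finset V} {T : V → Finset V}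
    (hT : T ∈ certSets P) {p : ℝ} (hp : 0 < p) (hJ : J ⊆ P) (hP : P.Nonempty)
    (h3 : 3 * P.card * p ≤ 1) :
    ((certLinks J P T).card : ℝ) * p ^ (freeVerts J P T).card
      ≤ (3 * P.card * p) ^ (P.card - J.card)
        * ∏ v ∈ P, certWeight P (3 * P.card * p)⁻¹ (T v) := by
  classical
  have ha : (0 : ℝ) < P.card := by exact_mod_cast hP.card_pos
  set a : ℝ := (P.card : ℝ) with haa
  have hap : 0 < 3 * a * p := by positivity
  set F := freeVerts J P T with hF
  set M := P ∩ P.biUnion T with hM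
  have hlink : ∀ u ∈ F, (linkSet P T u).card ≤ 3 * P.card + M.card := by
    intro u hu
    have huP : u ∈ P := (Finset.mem_sdiff.1 (Finset.mem_filter.1 hu).1).1
    have hTu := Fintype.mem_piFinset.1 hT u
    rw [if_pos huP, Finset.mem_filter] at hTu
    refine (Finset.card_union_le _ _).trans ?_
    rw [Finset.card_product, Finset.card_product, Finset.card_singleton, mul_one]
    have := Nat.mul_le_mul_left P.card hTu.2
    have e : (P ∩ P.biUnion T).card = M.card := rfl
    have e' : P.card * 3 = 3 * P.card := mul_comm _ _
    rw [e'] at this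
    refine add_le_add this (le_of_eq ?_)
    convert e
  have hcard : ((certLinks J P T).card : ℝ) ≤ (3 * a + M.card) ^ F.card := by
    rw [certLinks, Fintype.card_piFinset]
    have : ∏ u, (if u ∈ F then linkSet P T u else {(u, u)}).card
        = ∏ u ∈ F, (linkSet P T u).card := by
      rw [← Finset.prod_subset (Finset.subset_univ F)]
      · exact Finset.prod_congr rfl fun u hu => by rw [if_pos hu]
      · intro u _ hu
        rw [if_neg hu, Finset.card_singleton]
    rw [this]
    have h := Finset.prod_le_pow_card F (fun u => (linkSet P T u).card) _ hlink
    have : ((∏ u ∈ F, (linkSet P T u).card : ℕ) : ℝ)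
        ≤ (((3 * P.card + M.card) ^ F.card : ℕ) : ℝ) := by exact_mod_cast h
    push_cast at this ⊢
    exact this
  have hFle : F.card ≤ P.card :=
    Finset.card_le_card ((Finset.filter_subset _ _).trans Finset.sdiff_subset)
  have hMle : (M.card : ℝ) ≤ ∑ v ∈ P, ((T v ∩ P).card : ℝ) := by
    have h1 : M ⊆ P.biUnion fun v => T v ∩ P := by
      intro x hx
      rw [hM, Finset.mem_inter, Finset.mem_biUnion] at hx
      obtain ⟨hxP, v, hv, hxv⟩ := hx
      exact Finset.mem_biUnion.2 ⟨v, hv, Finset.mem_inter.2 ⟨hxv, hxP⟩⟩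
    exact_mod_cast (Finset.card_le_card h1).trans Finset.card_biUnion_le
  have hexp : (3 * a + M.card) ^ F.card ≤ (3 * a) ^ F.card * Real.exp (M.card / 3) := by
    have h1 : 3 * a + M.card ≤ 3 * a * Real.exp (M.card / (3 * a)) := by
      have := Real.add_one_le_exp ((M.card : ℝ) / (3 * a))
      have h2 := mul_le_mul_of_nonneg_left this (show 0 ≤ 3 * a by positivity)
      rw [mul_add, mul_div_cancel₀ _ (by positivity)] at h2
      linarith
    refine (pow_le_pow_left₀ (by positivity) h1 _).trans ?_
    rw [mul_pow, ← Real.exp_nat_mul]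
    refine mul_le_mul_of_nonneg_left (Real.exp_le_exp.2 ?_) (by positivity)
    have hf : (F.card : ℝ) ≤ a := Nat.cast_le.2 hFle
    rw [mul_div_assoc', div_le_div_iff₀ (by positivity) (by norm_num)]
    nlinarith [Nat.cast_nonneg (α := ℝ) M.card]
  have hprod : (3 * a * p) ^ F.card ≤ (3 * a * p) ^ (P.card - J.card)
      * ∏ v ∈ P, (if Disjoint (T v) P then 1 else (3 * a * p)⁻¹) := by
    have e : P.card - J.card = F.card + ((P \ J).filter fun u => ¬ Disjoint (T u) P).card := by
      rw [← Finset.card_sdiff_of_subset hJ, hF, freeVerts]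
      convert (Finset.card_filter_add_card_filter_not (s := P \ J)
        (fun u => Disjoint (T u) P)).symm
    have hJb : (3 * a * p)⁻¹ ^ ((P \ J).filter fun u => ¬ Disjoint (T u) P).card
        ≤ ∏ v ∈ P, (if Disjoint (T v) P then 1 else (3 * a * p)⁻¹) := by
      rw [Finset.prod_ite, Finset.prod_const_one, one_mul, Finset.prod_const]
      refine pow_le_pow_right₀ (one_le_inv₀ hap |>.2 h3) (Finset.card_le_card ?_)
      exact Finset.filter_subset_filter _ Finset.sdiff_subset
    calc (3 * a * p) ^ F.card = (3 * a * p) ^ (P.card - J.card) *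
          (3 * a * p)⁻¹ ^ ((P \ J).filter fun u => ¬ Disjoint (T u) P).card := by
          rw [e, pow_add, mul_assoc (_ ^ _), ← mul_pow (3 * a * p), mul_inv_cancel₀ hap.ne', one_pow, mul_one]
      _ ≤ _ := mul_le_mul_of_nonneg_left hJb (by positivity)
  calc ((certLinks J P T).card : ℝ) * p ^ F.card
      ≤ ((3 * a) ^ F.card * Real.exp (M.card / 3)) * p ^ F.card :=
        mul_le_mul_of_nonneg_right (hcard.trans hexp) (by positivity)
    _ = (3 * a * p) ^ F.card * Real.exp (M.card / 3) := by rw [mul_pow (3 * a) p]; ring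
    _ ≤ ((3 * a * p) ^ (P.card - J.card)
          * ∏ v ∈ P, (if Disjoint (T v) P then 1 else (3 * a * p)⁻¹))
          * Real.exp (∑ v ∈ P, ((T v ∩ P).card : ℝ) / 3) := by
        refine mul_le_mul hprod (Real.exp_le_exp.2 ?_) (Real.exp_pos _).le ?_
        · rw [← Finset.sum_div]
          linarith
        · exact mul_nonneg (by positivity) (Finset.prod_nonneg fun v _ => by
            split_ifs <;> positivity)
    _ = _ := by
        rw [Real.exp_sum, mul_assoc, ← Finset.prod_mul_distrib]
        refine congrArg _ (Finset.prod_congr rfl fun v _ => ?_)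
        rw [certWeight, mul_comm]

theorem prG_cylinder_le {n : ℕ} {p : ℝ} (h0 : 0 ≤ p) (h1 : p ≤ 1)
    (F H : Finset (Sym2 (Fin n))) (hH : H ⊆ allEdges n) (hFH : Disjoint F H) :
    prG n p (fun G => (∀ e ∈ F, e ∈ G.edgeSet) ∧ ∀ e ∈ H, e ∉ G.edgeSet)
      ≤ p ^ F.card * (1 - p) ^ H.card := by
  by_cases hF : F ⊆ allEdges n
  · exact (prG_cylinder F H hF hH hFH).le
  · have : prG n p (fun G => (∀ e ∈ F, e ∈ G.edgeSet) ∧ ∀ e ∈ H, e ∉ G.edgeSet)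
        ≤ ∑ i ∈ (∅ : Finset ℕ), prG n p fun _ => False := by
      refine prG_exists_le h0 h1 _ _ _ fun G hG => absurd (fun e he => ?_) hF
      exact Finset.mem_filter.2 ⟨Finset.mem_univ _, G.not_isDiag_of_mem_edgeSet (hG.1 e he)⟩
    refine this.trans ?_
    rw [Finset.sum_empty]
    exact mul_nonneg (pow_nonneg h0 _) (pow_nonneg (by linarith) _)

/-- The base of the exponential bound on the probability that a certificate exists. -/
noncomputable def certBase (x y : ℝ) : ℝ :=
  expTrunc 3 x + Real.exp (1 / 3) / 3 * expTrunc 2 x + Real.exp 1 / 3 * y * expTrunc 1 x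

theorem prG_hasCert_le {n : ℕ} {p : ℝ} (h0 : 0 < p) (h1 : p ≤ 1) {J P : Finset (Fin n)}
    (hJ : J ⊆ P) (hP : P.Nonempty) (h3 : 3 * P.card * p ≤ 1) :
    prG n p (fun G => HasCert G J P) ≤ (3 * P.card * p) ^ (P.card - J.card) *
      certBase (n * p) (P.card * p) ^ P.card * (1 - p) ^ (P.card * (n - 4 * P.card)) := by
  classical
  have ha : (0 : ℝ) < P.card := by exact_mod_cast hP.card_pos
  have hap : 0 < 3 * (P.card : ℝ) * p := by positivity
  set c := (1 - p) ^ (P.card * (n - 4 * P.card)) with hc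
  have hc0 : 0 ≤ c := pow_nonneg (by linarith) _
  have hone : ∀ T ∈ certSets P, ∀ l ∈ certLinks J P T, prG n p (fun G =>
      (certEdges J P T l).card = ∑ v ∈ P, (T v).card + (freeVerts J P T).card ∧
      (∀ e ∈ certEdges J P T l, e ∈ G.edgeSet) ∧ ∀ e ∈ certNonEdges P T, e ∉ G.edgeSet)
      ≤ p ^ (∑ v ∈ P, (T v).card) * p ^ (freeVerts J P T).card * c := by
    intro T hT l hl
    by_cases hcard : (certEdges J P T l).card = ∑ v ∈ P, (T v).card + (freeVerts J P T).card
    · have hH : certNonEdges P T ⊆ allEdges n := by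
        intro e he
        obtain ⟨v, hv, x, hx, rfl⟩ := exists_of_mem_certNonEdges he
        refine Finset.mem_filter.2 ⟨Finset.mem_univ _, fun h => ?_⟩
        rw [Sym2.mk_isDiag_iff] at h
        exact hx (h ▸ hv)
      refine (prG_mono h0.le h1 (fun G hG => hG.2)).trans ((prG_cylinder_le h0.le h1 _ _ hH
        (disjoint_certEdges_certNonEdges hl)).trans ?_)
      rw [hcard, pow_add]
      refine mul_le_mul_of_nonneg_left ?_ (by positivity)
      have := certNonEdges_card hT
      rw [Fintype.card_fin] at this
      exact pow_le_pow_of_le_one (by linarith) (by linarith) this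
    · have : prG n p (fun G =>
          (certEdges J P T l).card = ∑ v ∈ P, (T v).card + (freeVerts J P T).card ∧
          (∀ e ∈ certEdges J P T l, e ∈ G.edgeSet) ∧ ∀ e ∈ certNonEdges P T, e ∉ G.edgeSet)
          ≤ ∑ i ∈ (∅ : Finset ℕ), prG n p fun _ => False :=
        prG_exists_le h0.le h1 _ _ _ fun G hG => absurd hG.1 hcard
      exact this.trans (by rw [Finset.sum_empty]; positivity)
  have hsum : prG n p (fun G => HasCert G J P) ≤ ∑ T ∈ certSets P,
      p ^ (∑ v ∈ P, (T v).card) * ((certLinks J P T).card * p ^ (freeVerts J P T).card) * c := by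
    refine (prG_exists_le h0.le h1 (certSets P) _ _ fun G hG => hG).trans
      (Finset.sum_le_sum fun T hT => ?_)
    refine (prG_exists_le h0.le h1 (certLinks J P T) _ _ fun G hG => hG).trans
      ((Finset.sum_le_sum fun l hl => hone T hT l hl).trans (le_of_eq ?_))
    rw [Finset.sum_const, nsmul_eq_mul]
    ring
  set θ := (3 * (P.card : ℝ) * p)⁻¹ with hθ
  have hθ0 : 0 ≤ θ := by positivity
  have hprod : ∑ T ∈ certSets P, ∏ v ∈ P, p ^ (T v).card * certWeight P θ (T v)
      = (∑ S ∈ (Finset.univ : Finset (Finset (Fin n))).filter (fun S => S.card ≤ 3),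
        p ^ S.card * certWeight P θ S) ^ P.card := by
    have h := Finset.prod_univ_sum (R := ℝ) (fun v : Fin n => if v ∈ P then
      (Finset.univ : Finset (Finset (Fin n))).filter (fun S => S.card ≤ 3) else {∅})
      (fun v S => if v ∈ P then p ^ S.card * certWeight P θ S else 1)
    have e1 : ∏ v : Fin n, ∑ S ∈ (if v ∈ P then
        (Finset.univ : Finset (Finset (Fin n))).filter (fun S => S.card ≤ 3) else {∅}),
        (if v ∈ P then p ^ S.card * certWeight P θ S else 1)
        = ∏ v : Fin n, if v ∈ P then
          (∑ S ∈ (Finset.univ : Finset (Finset (Fin n))).filter (fun S => S.card ≤ 3),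
          p ^ S.card * certWeight P θ S) else 1 := by
      refine Finset.prod_congr rfl fun v _ => ?_
      by_cases hv : v ∈ P
      · simp only [if_pos hv]
      · simp only [if_neg hv, Finset.sum_singleton]
    rw [e1, Finset.prod_ite_mem, Finset.univ_inter, Finset.prod_const] at h
    rw [h, certSets]
    refine Finset.sum_congr (by congr!) fun T _ => ?_
    rw [Finset.prod_ite_mem, Finset.univ_inter]
  calc prG n p (fun G => HasCert G J P)
      ≤ ∑ T ∈ certSets P, (3 * P.card * p) ^ (P.card - J.card) *
          (∏ v ∈ P, p ^ (T v).card * certWeight P θ (T v)) * c := by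
        refine hsum.trans (Finset.sum_le_sum fun T hT => mul_le_mul_of_nonneg_right ?_ hc0)
        refine (mul_le_mul_of_nonneg_left (certLinks_card_le hT h0 hJ hP h3)
          (by positivity)).trans (le_of_eq ?_)
        rw [Finset.prod_mul_distrib, Finset.prod_pow_eq_pow_sum]
        ring
    _ = (3 * P.card * p) ^ (P.card - J.card) *
          (∑ S ∈ (Finset.univ : Finset (Finset (Fin n))).filter (fun S => S.card ≤ 3),
        p ^ S.card * certWeight P θ S) ^ P.card * c := by
        rw [← hprod, ← Finset.sum_mul, ← Finset.mul_sum]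
    _ ≤ _ := by
        have hw : ∀ S : Finset (Fin n), 0 ≤ p ^ S.card * certWeight P θ S := fun S => by
          unfold certWeight
          split_ifs <;> positivity
        gcongr
        · exact Finset.sum_nonneg fun S _ => hw S
        refine (sum_certWeight_le h0.le hθ0 P).trans (le_of_eq ?_)
        rw [Fintype.card_fin, certBase, hθ]
        field_simp

section PastSize

variable {V : Type*} [Fintype V] {G : SimpleGraph V} {A : Finset V} {τ : V → ℕ}

open Classical in
theorem elimPast_subset_biUnion (J : Finset V) :
    elimPast G A τ J ⊆ J.biUnion fun v => elimPast G A τ {v} := by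
  intro u hu
  obtain ⟨huA, v, hv, h⟩ := mem_elimPast.1 hu
  exact Finset.mem_biUnion.2 ⟨v, hv, mem_elimPast.2 ⟨huA, v, Finset.mem_singleton_self v, h⟩⟩

open Classical in
theorem elimDependsOn_card_le (hinj : Set.InjOn τ A) {m : ℕ}
    (hdeg : ∀ v, (Finset.univ.filter fun x => G.Adj v x).card < m) (w : V) :
    (Finset.univ.filter fun u => ElimDependsOn G A τ w u).card ≤ 1 + 2 * m := by
  let N := Finset.univ.filter fun x => G.Adj w x
  let D : V → Finset V := fun x => A.filter fun u => x ∈ newNbrs G A τ u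
  have hD : ∀ x, (D x).card ≤ 1 := by
    intro x
    rw [Finset.card_le_one]
    intro u hu v hv
    rw [Finset.mem_filter] at hu hv
    exact disjoint_newNbrs hinj hu.1 hv.1 hu.2 hv.2
  have hsub : (Finset.univ.filter fun u => ElimDependsOn G A τ w u)
      ⊆ D w ∪ (N.biUnion D ∪ N) := by
    intro u hu
    obtain ⟨huA, _, h | ⟨x, hx, hwx⟩ | ⟨hwu, _⟩⟩ := (Finset.mem_filter.1 hu).2
    · exact Finset.mem_union_left _ (Finset.mem_filter.2 ⟨huA, h⟩)
    · refine Finset.mem_union_right _ (Finset.mem_union_left _ (Finset.mem_biUnion.2 ⟨x, ?_, ?_⟩))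
      · exact Finset.mem_filter.2 ⟨Finset.mem_univ _, hwx⟩
      · exact Finset.mem_filter.2 ⟨huA, hx⟩
    · exact Finset.mem_union_right _ (Finset.mem_union_right _
        (Finset.mem_filter.2 ⟨Finset.mem_univ _, hwu⟩))
  have h1 := Finset.card_le_card hsub
  have h2 := Finset.card_union_le (D w) (N.biUnion D ∪ N)
  have h3 := Finset.card_union_le (N.biUnion D) N
  have h4 := Finset.card_biUnion_le_card_mul N D 1 fun x _ => hD x
  have h5 := hD w
  have h6 : N.card < m := hdeg w
  omega

open Classical in
/-- Under a degree bound, pasts are small provided no past has intermediate size. -/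
theorem elimPast_card_lt (hE : IsElimination G A τ) {m : ℕ}
    (hdeg : ∀ v, (Finset.univ.filter fun x => G.Adj v x).card < m)
    (hno : ∀ v P, v ∈ P → m ≤ P.card → P.card ≤ 3 * m ^ 2 → ¬ HasCert G {v} P) :
    ∀ v ∈ A, (elimPast G A τ {v}).card < m := by
  have key : ∀ t, ∀ v ∈ A, τ v < t → (elimPast G A τ {v}).card < m := by
    intro t
    induction t with
    | zero => intro v _ h; omega
    | succ t ih =>
      intro v hv hvt
      by_contra hlt
      push Not at hlt
      let D := Finset.univ.filter fun u => ElimDependsOn G A τ v u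
      have hsub : elimPast G A τ {v} ⊆ {v} ∪ D.biUnion fun u => elimPast G A τ {u} := by
        intro x hx
        obtain ⟨hxA, v', hv', h⟩ := mem_elimPast.1 hx
        rw [Finset.mem_singleton] at hv'
        subst hv'
        rcases Relation.ReflTransGen.cases_head h with rfl | ⟨u, hvu, hux⟩
        · exact Finset.mem_union_left _ (Finset.mem_singleton_self _)
        · refine Finset.mem_union_right _ (Finset.mem_biUnion.2 ⟨u, ?_, ?_⟩)
          · exact Finset.mem_filter.2 ⟨Finset.mem_univ _, hvu⟩
          · exact mem_elimPast.2 ⟨hxA, u, Finset.mem_singleton_self u, hux⟩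
      have hm : 0 < m := lt_of_le_of_lt (Nat.zero_le _) (hdeg v)
      have hD : D.card ≤ 1 + 2 * (m - 1 + 1) := by
        rw [Nat.sub_add_cancel hm]
        exact elimDependsOn_card_le hE.injOn hdeg v
      have h1 := Finset.card_le_card hsub
      have h2 := Finset.card_union_le {v} (D.biUnion fun u => elimPast G A τ {u})
      have h3 := Finset.card_biUnion_le_card_mul D (fun u => elimPast G A τ {u}) (m - 1)
        fun u hu => by
          have hu' := (Finset.mem_filter.1 hu).2
          have := ih u hu'.1 (by have := hu'.2.1; omega)
          omega
      have h4 : D.card * (m - 1) ≤ (1 + 2 * (m - 1 + 1)) * (m - 1) := Nat.mul_le_mul_right _ hD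
      refine hno v _ (subset_elimPast (by simpa using hv) (Finset.mem_singleton_self v)) hlt ?_
        (hasCert_elimPast hE (by simpa using hv))
      rw [Finset.card_singleton] at h2
      obtain ⟨k, rfl⟩ : ∃ k, m = k + 1 := ⟨m - 1, by omega⟩
      rw [Nat.add_sub_cancel] at h3 h4
      nlinarith
  exact fun v hv => key (τ v + 1) v hv (Nat.lt_succ_self _)

open Classical in
theorem exists_hasCert_of_subset (hE : IsElimination G A τ) {m : ℕ}
    (hdeg : ∀ v, (Finset.univ.filter fun x => G.Adj v x).card < m)
    (hno : ∀ v P, v ∈ P → m ≤ P.card → P.card ≤ 3 * m ^ 2 → ¬ HasCert G {v} P)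
    {J : Finset V} (hJ : J ⊆ A) (hJm : J.card = m) :
    ∃ P, J ⊆ P ∧ P.card ≤ 3 * m ^ 2 ∧ HasCert G J P := by
  refine ⟨_, subset_elimPast hJ, ?_, hasCert_elimPast hE hJ⟩
  have h1 := Finset.card_le_card (elimPast_subset_biUnion (G := G) (A := A) (τ := τ) J)
  have h2 := Finset.card_biUnion_le_card_mul J (fun v => elimPast G A τ {v}) m fun v hv =>
    (elimPast_card_lt hE hdeg hno v (hJ hv)).le
  rw [hJm] at h2
  nlinarith

end PastSize

theorem certBase_nonneg {x y : ℝ} (hx : 0 ≤ x) (hy : 0 ≤ y) : 0 ≤ certBase x y := by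
  have h1 := expTrunc_nonneg 1 hx
  have h2 := expTrunc_nonneg 2 hx
  have h3 := expTrunc_nonneg 3 hx
  unfold certBase
  positivity

open Classical in
theorem sum_prG_hasCert_le {n : ℕ} {d : ℝ} (hd : 0 < d) (hdn : d ≤ n) {J : Finset (Fin n)}
    (hJ : J.Nonempty) (a : ℕ) (h3 : 3 * a * (d / n) ≤ 1) {ρ : ℝ}
    (hρ : 3 * d * Real.exp 1 * certBase d (a * (d / n)) * Real.exp (-d + 4 * (a * (d / n))) ≤ ρ) :
    ∑ P ∈ Finset.univ.filter (fun P : Finset (Fin n) => J ⊆ P ∧ P.card = a),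
      prG n (d / n) (fun G => HasCert G J P) ≤ ρ ^ a * (3 * d)⁻¹ ^ J.card := by
  have hn : (0 : ℝ) < n := hd.trans_le hdn
  have hp0 : 0 < d / n := div_pos hd hn
  have hp1 : d / n ≤ 1 := (div_le_one hn).2 hdn
  set p := d / n with hp
  have hnp : (n : ℝ) * p = d := mul_div_cancel₀ d hn.ne'
  have hB := certBase_nonneg hd.le (show 0 ≤ a * p by positivity)
  have hρ0 : 0 ≤ ρ := le_trans (by positivity) hρ
  by_cases haj : a < J.card
  · rw [Finset.sum_eq_zero]
    · positivity
    · intro P hP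
      have hP := (Finset.mem_filter.1 hP).2
      have := Finset.card_le_card hP.1
      omega
  push Not at haj
  obtain ⟨k, hk⟩ := Nat.exists_eq_add_of_le haj
  have hkj : a - J.card = k := by omega
  have hcount : (((Finset.univ.filter
      (fun P : Finset (Fin n) => J ⊆ P ∧ P.card = a)).card : ℕ) : ℝ) ≤ n ^ k / k.factorial := by
    have h1 : (Finset.univ.filter (fun P : Finset (Fin n) => J ⊆ P ∧ P.card = a)).card
        ≤ (Finset.powersetCard k (Finset.univ : Finset (Fin n))).card := by
      refine Finset.card_le_card_of_injOn (fun P => P \ J) ?_ ?_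
      · intro P hP
        have hP := (Finset.mem_filter.1 hP).2
        refine Finset.mem_coe.2 (Finset.mem_powersetCard.2 ⟨Finset.subset_univ _, ?_⟩)
        rw [Finset.card_sdiff_of_subset hP.1, hP.2, hkj]
      · intro P hP P' hP' heq
        have hP := (Finset.mem_filter.1 hP).2
        have hP' := (Finset.mem_filter.1 hP').2
        simp only at heq
        rw [← Finset.sdiff_union_of_subset hP.1, heq, Finset.sdiff_union_of_subset hP'.1]
    rw [Finset.card_powersetCard, Finset.card_univ, Fintype.card_fin] at h1
    exact (Nat.cast_le.2 h1).trans (Nat.choose_le_pow_div _ _)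
  have hq : (1 - p) ^ (a * (n - 4 * a)) ≤ Real.exp (-d + 4 * (a * p)) ^ a := by
    rw [← Real.exp_nat_mul]
    have h1 : 1 - p ≤ Real.exp (-p) := by linarith [Real.add_one_le_exp (-p)]
    refine (pow_le_pow_left₀ (by linarith) h1 _).trans ?_
    rw [← Real.exp_nat_mul, Real.exp_le_exp]
    have h2 : (n : ℝ) - 4 * a ≤ ((n - 4 * a : ℕ) : ℝ) := by
      rw [sub_le_iff_le_add]
      exact_mod_cast (by omega : n ≤ n - 4 * a + 4 * a)
    have h3 := mul_le_mul_of_nonneg_left h2 (show 0 ≤ a * p by positivity)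
    push_cast
    have h4 : (a : ℝ) * p * (n - 4 * a) = a * (d - 4 * (a * p)) := by rw [← hnp]; ring
    nlinarith
  set b := (3 * a * p) ^ k * certBase d (a * p) ^ a * Real.exp (-d + 4 * (a * p)) ^ a with hb
  calc _ ≤ ∑ P ∈ Finset.univ.filter (fun P : Finset (Fin n) => J ⊆ P ∧ P.card = a), b := by
        refine Finset.sum_le_sum fun P hP => ?_
        obtain ⟨hJP, hPa⟩ := (Finset.mem_filter.1 hP).2
        have := prG_hasCert_le (n := n) hp0 hp1 hJP (hJ.mono hJP) (by rwa [hPa])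
        rw [hPa, hkj, hnp] at this
        exact this.trans (mul_le_mul_of_nonneg_left hq (by positivity))
    _ ≤ n ^ k / k.factorial * b := by
        rw [Finset.sum_const, nsmul_eq_mul]
        exact mul_le_mul_of_nonneg_right hcount (by positivity)
    _ = (3 * d) ^ k * ((a : ℝ) ^ k / k.factorial) *
          (certBase d (a * p) * Real.exp (-d + 4 * (a * p))) ^ a := by
        rw [hb, ← hnp]
        simp only [mul_pow]
        ring
    _ ≤ (3 * d) ^ k * Real.exp 1 ^ a *
          (certBase d (a * p) * Real.exp (-d + 4 * (a * p))) ^ a := by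
        gcongr
        rw [← Real.exp_nat_mul, mul_one]
        exact Real.pow_div_factorial_le_exp _ (Nat.cast_nonneg a) k
    _ = (3 * d * Real.exp 1 * certBase d (a * p) * Real.exp (-d + 4 * (a * p))) ^ a
          * (3 * d)⁻¹ ^ J.card := by
        have : (3 * d) ^ k = (3 * d) ^ a * (3 * d)⁻¹ ^ J.card := by
          rw [hk, pow_add, mul_comm (_ ^ J.card), mul_assoc, ← mul_pow,
            mul_inv_cancel₀ (by positivity), one_pow, mul_one]
        rw [this]
        simp only [mul_pow]
        ring
    _ ≤ _ := by gcongr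

open Classical in
theorem prG_exists_degree_ge_le {n : ℕ} {p : ℝ} (h0 : 0 ≤ p) (h1 : p ≤ 1) (m : ℕ) :
    prG n p (fun G => ∃ v, m ≤ (Finset.univ.filter fun x => G.Adj v x).card)
      ≤ n * ((n * p) ^ m / m.factorial) := by
  have hone : ∀ v : Fin n, prG n p
      (fun G => m ≤ (Finset.univ.filter fun x => G.Adj v x).card)
      ≤ (n * p) ^ m / m.factorial := by
    intro v
    refine (prG_exists_le h0 h1 (Finset.powersetCard m Finset.univ) _
      (fun S G => (∀ e ∈ S.image fun x => s(v, x), e ∈ G.edgeSet) ∧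
        ∀ e ∈ (∅ : Finset (Sym2 (Fin n))), e ∉ G.edgeSet) fun G hG => ?_).trans ?_
    · obtain ⟨S, hS, hSm⟩ := Finset.exists_subset_card_eq hG
      refine ⟨S, Finset.mem_powersetCard.2 ⟨Finset.subset_univ _, hSm⟩, ?_, by simp⟩
      intro e he
      obtain ⟨x, hx, rfl⟩ := Finset.mem_image.1 he
      exact (Finset.mem_filter.1 (hS hx)).2
    · calc _ ≤ ∑ S ∈ Finset.powersetCard m (Finset.univ : Finset (Fin n)), p ^ m := by
            refine Finset.sum_le_sum fun S hS => ?_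
            refine (prG_cylinder_le h0 h1 _ ∅ (by simp) (by simp)).trans (le_of_eq ?_)
            rw [Finset.card_image_of_injective, (Finset.mem_powersetCard.1 hS).2]
            · simp
            · intro x y h
              exact Sym2.congr_right.1 h
        _ = (n.choose m : ℝ) * p ^ m := by
            rw [Finset.sum_const, Finset.card_powersetCard, nsmul_eq_mul, Finset.card_univ,
              Fintype.card_fin]
        _ ≤ (n ^ m / m.factorial : ℝ) * p ^ m :=
            mul_le_mul_of_nonneg_right (Nat.choose_le_pow_div _ _) (by positivity)
        _ = _ := by rw [mul_pow]; ring
  refine (prG_exists_le h0 h1 Finset.univ _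
    (fun v G => m ≤ (Finset.univ.filter fun x => G.Adj v x).card) fun G ⟨v, hv⟩ =>
    ⟨v, Finset.mem_univ v, hv⟩).trans ((Finset.sum_le_sum fun v _ => hone v).trans ?_)
  rw [Finset.sum_const, nsmul_eq_mul, Finset.card_univ, Fintype.card_fin]

open Classical in
theorem sum_Icc_prG_hasCert_le {n m : ℕ} {d ρ : ℝ} (hd : 0 < d) (hdn : d ≤ n) (hρ0 : 0 ≤ ρ)
    (hρ1 : ρ ≤ 1) (hm : 0 < m) (H : ∀ a : ℕ, a ≤ 3 * m ^ 2 → 3 * a * (d / n) ≤ 1 ∧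
      3 * d * Real.exp 1 * certBase d (a * (d / n)) * Real.exp (-d + 4 * (a * (d / n))) ≤ ρ)
    {J : Finset (Fin n)} (hJ : J.Nonempty) :
    ∑ a ∈ Finset.Icc m (3 * m ^ 2),
      ∑ P ∈ Finset.univ.filter (fun P : Finset (Fin n) => J ⊆ P ∧ P.card = a),
        prG n (d / n) (fun G => HasCert G J P) ≤ 3 * m ^ 2 * (ρ ^ m * (3 * d)⁻¹ ^ J.card) := by
  calc _ ≤ ∑ a ∈ Finset.Icc m (3 * m ^ 2), ρ ^ m * (3 * d)⁻¹ ^ J.card := by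
        refine Finset.sum_le_sum fun a ha => ?_
        rw [Finset.mem_Icc] at ha
        refine (sum_prG_hasCert_le hd hdn hJ a (H a ha.2).1 (H a ha.2).2).trans ?_
        exact mul_le_mul_of_nonneg_right (pow_le_pow_of_le_one hρ0 hρ1 ha.1) (by positivity)
    _ ≤ _ := by
        rw [Finset.sum_const, nsmul_eq_mul]
        refine mul_le_mul_of_nonneg_right ?_ (by positivity)
        have : (Finset.Icc m (3 * m ^ 2)).card ≤ 3 * m ^ 2 := by
          rw [Nat.card_Icc]
          omega
        exact_mod_cast this

theorem prG_exists_hasCert_le {n m : ℕ} {d ρ : ℝ} (hd : 0 < d) (hdn : d ≤ n) (hρ0 : 0 ≤ ρ)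
    (hρ1 : ρ ≤ 1) (hm : 0 < m) (H : ∀ a : ℕ, a ≤ 3 * m ^ 2 → 3 * a * (d / n) ≤ 1 ∧
      3 * d * Real.exp 1 * certBase d (a * (d / n)) * Real.exp (-d + 4 * (a * (d / n))) ≤ ρ) :
    prG n (d / n) (fun G => ∃ v P, v ∈ P ∧ m ≤ P.card ∧ P.card ≤ 3 * m ^ 2 ∧ HasCert G {v} P)
      ≤ n * (3 * m ^ 2 * (ρ ^ m * (3 * d)⁻¹)) := by
  classical
  have hn : (0 : ℝ) < n := hd.trans_le hdn
  have hp0 : 0 ≤ d / n := (div_pos hd hn).le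
  have hp1 : d / n ≤ 1 := (div_le_one hn).2 hdn
  refine (prG_exists_le hp0 hp1 Finset.univ _ (fun v G => ∃ P, v ∈ P ∧ m ≤ P.card ∧
    P.card ≤ 3 * m ^ 2 ∧ HasCert G {v} P) fun G ⟨v, hv⟩ => ⟨v, Finset.mem_univ v, hv⟩).trans ?_
  have hone : ∀ v : Fin n, prG n (d / n) (fun G => ∃ P, v ∈ P ∧ m ≤ P.card ∧
      P.card ≤ 3 * m ^ 2 ∧ HasCert G {v} P) ≤ 3 * m ^ 2 * (ρ ^ m * (3 * d)⁻¹) := by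
    intro v
    have h := sum_Icc_prG_hasCert_le hd hdn hρ0 hρ1 hm H (Finset.singleton_nonempty v)
    rw [Finset.card_singleton, pow_one] at h
    refine le_trans ?_ h
    refine (prG_exists_le hp0 hp1 (Finset.Icc m (3 * m ^ 2)) _ (fun a G =>
      ∃ P ∈ Finset.univ.filter (fun P : Finset (Fin n) => {v} ⊆ P ∧ P.card = a),
        HasCert G {v} P) fun G ⟨P, hv, h1, h2, h3⟩ => ?_).trans
      (Finset.sum_le_sum fun a _ => prG_exists_le hp0 hp1 _ _ _ fun G hG => hG)
    exact ⟨P.card, Finset.mem_Icc.2 ⟨h1, h2⟩, P, Finset.mem_filter.2 ⟨Finset.mem_univ _,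
      Finset.singleton_subset_iff.2 hv, rfl⟩, h3⟩
  refine (Finset.sum_le_sum fun v _ => hone v).trans ?_
  rw [Finset.sum_const, nsmul_eq_mul, Finset.card_univ, Fintype.card_fin]

open Classical in
theorem choose_mul_prG_core_le {n m : ℕ} {d ρ : ℝ} (hd : 0 < d) (hdn : d ≤ n) (hρ0 : 0 ≤ ρ)
    (hρ1 : ρ ≤ 1) (hm : 0 < m) (H : ∀ a : ℕ, a ≤ 3 * m ^ 2 → 3 * a * (d / n) ≤ 1 ∧
      3 * d * Real.exp 1 * certBase d (a * (d / n)) * Real.exp (-d + 4 * (a * (d / n))) ≤ ρ) :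
    ((n / 8).choose m : ℝ) * prG n (d / n) (fun G => 2 * (strongCore G 4).ncard < n ∧
      (∀ v, (Finset.univ.filter fun x => G.Adj v x).card < m) ∧
      ∀ v P, v ∈ P → m ≤ P.card → P.card ≤ 3 * m ^ 2 → ¬ HasCert G {v} P)
      ≤ n.choose m * (3 * m ^ 2 * (ρ ^ m * (3 * d)⁻¹ ^ m)) := by
  have hn : (0 : ℝ) < n := hd.trans_le hdn
  have hp0 : 0 ≤ d / n := (div_pos hd hn).le
  have hp1 : d / n ≤ 1 := (div_le_one hn).2 hdn
  refine (mul_prG_le_sum_of_subset hp0 hp1 (Finset.powersetCard m Finset.univ) _ (fun J G =>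
    ∃ a ∈ Finset.Icc m (3 * m ^ 2), ∃ P ∈ Finset.univ.filter
      (fun P : Finset (Fin n) => J ⊆ P ∧ P.card = a), HasCert G J P)
      ((n / 8).choose m : ℝ) ?count).trans ?total
  case count =>
    rintro G ⟨hcore, hdeg, hno⟩
    obtain ⟨A, τ, hE, hA⟩ := IsElimination.exists_card_le (G := G)
    rw [Finset.card_univ, Fintype.card_fin] at hA
    have hA' : n / 8 ≤ A.card := by omega
    refine ⟨Finset.powersetCard m A, Finset.powersetCard_mono (Finset.subset_univ A), ?_,
      fun J hJ => ?_⟩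
    · rw [Finset.card_powersetCard]
      exact Nat.cast_le.2 (Nat.choose_le_choose m hA')
    obtain ⟨hJA, hJm⟩ := Finset.mem_powersetCard.1 hJ
    obtain ⟨P, hJP, hP, hcert⟩ := exists_hasCert_of_subset hE hdeg hno hJA hJm
    exact ⟨P.card, Finset.mem_Icc.2 ⟨hJm ▸ Finset.card_le_card hJP, hP⟩, P,
      Finset.mem_filter.2 ⟨Finset.mem_univ _, hJP, rfl⟩, hcert⟩
  case total =>
    calc _ ≤ ∑ J ∈ Finset.powersetCard m (Finset.univ : Finset (Fin n)),
            (3 * m ^ 2 * (ρ ^ m * (3 * d)⁻¹ ^ m) : ℝ) := by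
          refine Finset.sum_le_sum fun J hJ => ?_
          have hJm := (Finset.mem_powersetCard.1 hJ).2
          have h := sum_Icc_prG_hasCert_le hd hdn hρ0 hρ1 hm H
            (Finset.card_pos.1 (hJm.symm ▸ hm))
          rw [hJm] at h
          exact (prG_exists_le hp0 hp1 (Finset.Icc m (3 * m ^ 2)) _ _ fun G hG => hG).trans
            ((Finset.sum_le_sum fun a _ => prG_exists_le hp0 hp1 _ _ _ fun G hG => hG).trans h)
      _ = _ := by
          rw [Finset.sum_const, Finset.card_powersetCard, nsmul_eq_mul, Finset.card_univ,
            Fintype.card_fin]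

theorem exp_ten_ge : (22026 : ℝ) ≤ Real.exp 10 := by
  have : Real.exp 10 = Real.exp 1 ^ 10 := by
    rw [← Real.exp_nat_mul]
    norm_num
  rw [this]
  exact le_trans (by norm_num) (pow_le_pow_left₀ (by norm_num) Real.exp_one_gt_d9.le 10)

theorem certBase_zero_lt {d : ℝ} (hd : 10 ≤ d) :
    3 * d * Real.exp 1 * certBase d 0 * Real.exp (-d) < 0.99 := by
  have he1 := Real.exp_one_lt_d9
  have h13 : Real.exp (1 / 3) ≤ 1.396 := by
    by_contra h
    push Not at h
    have h3 : Real.exp (1 / 3) ^ 3 = Real.exp 1 := by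
      rw [← Real.exp_nat_mul]
      norm_num
    have := pow_lt_pow_left₀ h (by norm_num) (n := 3) (by norm_num)
    norm_num at this h3
    linarith
  obtain ⟨t, rfl⟩ : ∃ t, d = 10 + t := ⟨d - 10, by ring⟩
  have ht : 0 ≤ t := by linarith
  have h10 := exp_ten_ge
  have hser : 1 + t + t ^ 2 / 2 + t ^ 3 / 6 + t ^ 4 / 24 ≤ Real.exp t := by
    have := Real.sum_le_exp_of_nonneg ht 5
    simp only [Finset.sum_range_succ, Finset.sum_range_zero, Nat.factorial] at this
    norm_num at this
    linarith
  have hexp : 22026 * (1 + t + t ^ 2 / 2 + t ^ 3 / 6 + t ^ 4 / 24) ≤ Real.exp (10 + t) := by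
    rw [Real.exp_add]
    gcongr
  rw [Real.exp_neg, ← div_eq_mul_inv, div_lt_iff₀ (Real.exp_pos _)]
  refine lt_of_lt_of_le ?_ (mul_le_mul_of_nonneg_left hexp (by norm_num))
  have hB : certBase (10 + t) 0 ≤ (1 + (10 + t) + (10 + t) ^ 2 / 2 + (10 + t) ^ 3 / 6)
      + 0.4654 * (1 + (10 + t) + (10 + t) ^ 2 / 2) := by
    unfold certBase expTrunc
    simp only [Finset.sum_range_succ, Finset.sum_range_zero, Nat.factorial]
    norm_num
    nlinarith
  have hB0 : 0 ≤ certBase (10 + t) 0 := certBase_nonneg (by linarith) le_rfl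
  calc 3 * (10 + t) * Real.exp 1 * certBase (10 + t) 0
      ≤ 3 * (10 + t) * 2.7183 * ((1 + (10 + t) + (10 + t) ^ 2 / 2 + (10 + t) ^ 3 / 6)
        + 0.4654 * (1 + (10 + t) + (10 + t) ^ 2 / 2)) := by
        gcongr
        linarith
    _ < _ := by
        have h2 := pow_nonneg ht 2
        have h3 := pow_nonneg ht 3
        have h4 := pow_nonneg ht 4
        ring_nf
        linarith

theorem exists_certBase_le {d : ℝ} (hd : 10 ≤ d) : ∃ η > 0, ∀ y, 0 ≤ y → y ≤ η →
    3 * d * Real.exp 1 * certBase d y * Real.exp (-d + 4 * y) ≤ 0.99 := by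
  have hc : Continuous fun y : ℝ =>
      3 * d * Real.exp 1 * certBase d y * Real.exp (-d + 4 * y) := by
    unfold certBase
    fun_prop
  have h0 := certBase_zero_lt hd
  have hev := (hc.tendsto 0).eventually (gt_mem_nhds (show _ < (0.99 : ℝ) by simpa using h0))
  obtain ⟨ε, hε, h⟩ := Metric.eventually_nhds_iff.1 hev
  refine ⟨ε / 2, by positivity, fun y hy0 hy => (h ?_).le⟩
  rw [Real.dist_0_eq_abs, abs_of_nonneg hy0]
  linarith

theorem choose_le_pow_mul_choose {n m : ℕ} (h : 40 * m ≤ n) :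
    n.choose m ≤ 10 ^ m * (n / 8).choose m := by
  refine Nat.le_of_mul_le_mul_left ?_ m.factorial_pos
  calc m.factorial * n.choose m = n.descFactorial m := (Nat.descFactorial_eq_factorial_mul_choose n m).symm
    _ ≤ n ^ m := Nat.descFactorial_le_pow n m
    _ ≤ (10 * (n / 8 + 1 - m)) ^ m := Nat.pow_le_pow_left (by omega) m
    _ = 10 ^ m * (n / 8 + 1 - m) ^ m := mul_pow _ _ _
    _ ≤ 10 ^ m * (n / 8).descFactorial m :=
        Nat.mul_le_mul_left _ (Nat.pow_sub_le_descFactorial _ _)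
    _ = _ := by
        rw [Nat.descFactorial_eq_factorial_mul_choose]
        ring

theorem tendsto_pow_mul_geometric (k : ℕ) (c : ℝ) :
    Tendsto (fun m : ℕ => c * ((m + 1 : ℝ) ^ k * 0.99 ^ m)) atTop (nhds 0) := by
  have h := tendsto_pow_const_mul_const_pow_of_abs_lt_one (r := (0.99 : ℝ)) k (by
    rw [abs_of_nonneg] <;> norm_num)
  have h2 := ((tendsto_add_atTop_iff_nat 1).2 h).const_mul (c * 0.99⁻¹)
  rw [mul_zero] at h2
  refine h2.congr fun m => ?_
  push_cast
  rw [pow_succ]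
  ring

theorem prG_small_core_le {n m : ℕ} {d : ℝ} (hd : 10 ≤ d) (hdn : d ≤ n) (hm : 0 < m)
    (hmn : 40 * m ≤ n) (hnm : n ≤ (m + 1) ^ 4)
    (H : ∀ a : ℕ, a ≤ 3 * m ^ 2 → 3 * a * (d / n) ≤ 1 ∧
      3 * d * Real.exp 1 * certBase d (a * (d / n)) * Real.exp (-d + 4 * (a * (d / n))) ≤ 0.99) :
    n * prG n (d / n) (fun G => 2 * (strongCore G 4).ncard < n)
      ≤ (Real.exp (2 * d) + 6) * ((m + 1 : ℝ) ^ 10 * 0.99 ^ m) := by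
  classical
  have hd0 : 0 < d := by linarith
  have hn : (0 : ℝ) < n := hd0.trans_le hdn
  have hp0 : 0 ≤ d / n := (div_pos hd0 hn).le
  have hp1 : d / n ≤ 1 := (div_le_one hn).2 hdn
  have hm1 : (1 : ℝ) ≤ m := by exact_mod_cast hm
  have b1 := prG_exists_degree_ge_le (n := n) hp0 hp1 m
  rw [mul_div_cancel₀ d hn.ne'] at b1
  have b2 := prG_exists_hasCert_le hd0 hdn (by norm_num) (by norm_num) hm H
  have b3 := choose_mul_prG_core_le hd0 hdn (by norm_num) (by norm_num) hm H
  have hch : 0 < (n / 8).choose m := Nat.choose_pos (by omega)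
  have b3' : prG n (d / n) (fun G => 2 * (strongCore G 4).ncard < n ∧
      (∀ v, (Finset.univ.filter fun x => G.Adj v x).card < m) ∧
      ∀ v P, v ∈ P → m ≤ P.card → P.card ≤ 3 * m ^ 2 → ¬ HasCert G {v} P)
      ≤ 3 * m ^ 2 * 0.99 ^ m := by
    have hch' : (0 : ℝ) < (n / 8).choose m := by exact_mod_cast hch
    refine le_of_mul_le_mul_left (b3.trans ?_) hch'
    have h1 : (n.choose m : ℝ) ≤ 10 ^ m * (n / 8).choose m := by
      exact_mod_cast choose_le_pow_mul_choose hmn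
    have h2 : (10 : ℝ) ^ m * (3 * d)⁻¹ ^ m ≤ 1 := by
      rw [← mul_pow]
      refine pow_le_one₀ (by positivity) ?_
      rw [← div_eq_mul_inv, div_le_one (by positivity)]
      linarith
    calc (n.choose m : ℝ) * (3 * m ^ 2 * (0.99 ^ m * (3 * d)⁻¹ ^ m))
        ≤ (10 ^ m * (n / 8).choose m) * (3 * m ^ 2 * (0.99 ^ m * (3 * d)⁻¹ ^ m)) := by gcongr
      _ = (n / 8).choose m * (3 * m ^ 2 * 0.99 ^ m) * ((10 : ℝ) ^ m * (3 * d)⁻¹ ^ m) := by ring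
      _ ≤ (n / 8).choose m * (3 * m ^ 2 * 0.99 ^ m) * 1 := by gcongr
      _ = _ := mul_one _
  have hall : prG n (d / n) (fun G => 2 * (strongCore G 4).ncard < n)
      ≤ n * (d ^ m / m.factorial) + (n * (3 * m ^ 2 * (0.99 ^ m * (3 * d)⁻¹))
        + 3 * m ^ 2 * 0.99 ^ m) := by
    refine (prG_mono hp0 hp1 fun G hG => ?_).trans ((prG_or_le hp0 hp1 _ _).trans
      (add_le_add b1 ((prG_or_le hp0 hp1 _ _).trans (add_le_add b2 b3'))))
    by_cases h1 : ∃ v, m ≤ (Finset.univ.filter fun x => G.Adj v x).card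
    · exact Or.inl h1
    by_cases h2 : ∃ v P, v ∈ P ∧ m ≤ P.card ∧ P.card ≤ 3 * m ^ 2 ∧ HasCert G {v} P
    · exact Or.inr (Or.inl h2)
    push Not at h1 h2
    exact Or.inr (Or.inr ⟨hG, h1, h2⟩)
  have hfac : d ^ m / m.factorial ≤ Real.exp (2 * d) * 0.99 ^ m := by
    have h1 := Real.pow_div_factorial_le_exp (2 * d) (by positivity) m
    have h2 : d ^ m / m.factorial = (2 * d) ^ m / m.factorial * (1 / 2 : ℝ) ^ m := by
      rw [div_mul_eq_mul_div, ← mul_pow]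
      congr 2
      ring
    rw [h2]
    gcongr
    norm_num
  have hn4 : (n : ℝ) ≤ (m + 1 : ℝ) ^ 4 := by exact_mod_cast hnm
  have hn1 : (1 : ℝ) ≤ n := by linarith
  have hn8 : (n : ℝ) ^ 2 ≤ (m + 1 : ℝ) ^ 8 := by
    calc (n : ℝ) ^ 2 ≤ ((m + 1 : ℝ) ^ 4) ^ 2 := pow_le_pow_left₀ hn.le hn4 2
      _ = _ := by ring
  have hinv : (3 * d)⁻¹ ≤ 1 := inv_le_one_of_one_le₀ (by linarith)
  set q : ℝ := 0.99 ^ m with hq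
  have hq0 : 0 ≤ q := by positivity
  calc n * prG n (d / n) (fun G => 2 * (strongCore G 4).ncard < n)
      ≤ n * (n * (Real.exp (2 * d) * q) + (n * (3 * m ^ 2 * (q * 1)) + n * (3 * m ^ 2 * q))) := by
        refine mul_le_mul_of_nonneg_left (hall.trans ?_) hn.le
        refine add_le_add (by gcongr) (add_le_add (by gcongr) ?_)
        exact le_mul_of_one_le_left (by positivity) hn1
    _ = n ^ 2 * (Real.exp (2 * d) + 6 * m ^ 2) * q := by ring
    _ ≤ (m + 1) ^ 8 * (Real.exp (2 * d) * (m + 1) ^ 2 + 6 * (m + 1) ^ 2) * q := by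
        gcongr
        · exact le_mul_of_one_le_right (Real.exp_pos _).le (one_le_pow₀ (by linarith))
        · linarith
    _ = _ := by ring

theorem tendsto_mul_prG_small_core {d : ℝ} (hd : 10 ≤ d) :
    Tendsto (fun n : ℕ => (n : ℝ) *
      prG n (d / n) (fun G => 2 * (strongCore G 4).ncard < n)) atTop (nhds 0) := by
  obtain ⟨η, hη, hbase⟩ := exists_certBase_le hd
  have hd0 : 0 < d := by linarith
  let m : ℕ → ℕ := fun n => Nat.sqrt (Nat.sqrt n)
  have hsqrt : Tendsto Nat.sqrt atTop atTop := tendsto_atTop.2 fun b => by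
    filter_upwards [eventually_ge_atTop (b * b)] with n hn
    exact Nat.le_sqrt.2 hn
  have hm : Tendsto m atTop atTop := hsqrt.comp hsqrt
  have hmR : Tendsto (fun n => (m n : ℝ)) atTop atTop :=
    tendsto_natCast_atTop_atTop.comp hm
  have hlim := (tendsto_pow_mul_geometric 10 (Real.exp (2 * d) + 6)).comp hm
  refine squeeze_zero' ?_ ?_ hlim
  · filter_upwards [tendsto_natCast_atTop_atTop.eventually_ge_atTop d] with n hdn
    have hn : (0 : ℝ) < n := hd0.trans_le hdn
    exact mul_nonneg hn.le (prG_nonneg (div_pos hd0 hn).le ((div_le_one hn).2 hdn) _)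
  · filter_upwards [tendsto_natCast_atTop_atTop.eventually_ge_atTop d, hm.eventually_ge_atTop 40,
      hmR.eventually_ge_atTop (9 * d), hmR.eventually_ge_atTop (3 * d / η)]
      with n hdn hm40 hm9 hmη
    have hn : (0 : ℝ) < n := hd0.trans_le hdn
    have hs1 : m n * m n ≤ Nat.sqrt n := Nat.sqrt_le _
    have hs2 : Nat.sqrt n * Nat.sqrt n ≤ n := Nat.sqrt_le _
    have hs3 : Nat.sqrt n < (m n + 1) * (m n + 1) := Nat.lt_succ_sqrt _
    have hs4 : n < (Nat.sqrt n + 1) * (Nat.sqrt n + 1) := Nat.lt_succ_sqrt _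
    have h4 : (m n * m n) * (m n * m n) ≤ n := (Nat.mul_le_mul hs1 hs1).trans hs2
    have h3n : m n * (m n * m n) ≤ n := by
      refine le_trans ?_ h4
      rw [mul_assoc]
      exact Nat.mul_le_mul_left _ (Nat.le_mul_of_pos_left _ (by omega))
    have h40 : 40 * m n ≤ n := by
      refine le_trans ?_ h3n
      rw [mul_comm]
      refine Nat.mul_le_mul_left _ ?_
      nlinarith
    have h3nR : (m n : ℝ) * (m n * m n) ≤ n := by exact_mod_cast h3n
    have hm1 : (1 : ℝ) ≤ m n := by
      have : 1 ≤ m n := by omega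
      exact_mod_cast this
    have hnm : n ≤ (m n + 1) ^ 4 := by
      have : n ≤ ((m n + 1) * (m n + 1)) * ((m n + 1) * (m n + 1)) :=
        hs4.le.trans (Nat.mul_le_mul hs3 hs3)
      exact this.trans (le_of_eq (by ring))
    refine prG_small_core_le hd hdn (by omega) h40 hnm fun a ha => ?_
    have haR : (a : ℝ) ≤ 3 * m n ^ 2 := by exact_mod_cast ha
    have ham : (a : ℝ) * (d / n) * m n ≤ 3 * d := by
      rw [mul_div_assoc', div_mul_eq_mul_div, div_le_iff₀ hn]
      have : (a : ℝ) * m n ≤ 3 * n := by nlinarith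
      nlinarith
    have ha0 : 0 ≤ (a : ℝ) * (d / n) := by positivity
    constructor
    · by_contra hcon
      push Not at hcon
      nlinarith
    · refine hbase _ ha0 ?_
      rw [div_le_iff₀ hη] at hmη
      by_contra hcon
      push Not at hcon
      nlinarith

section SubsetExpectation

variable {α : Type*}

/-- The expectation of `f` over a random subset of `E` containing each element independently
with probability `p`. -/
noncomputable def subsetExp (p : ℝ) (E : Finset α) (f : Finset α → ℝ) : ℝ :=
  ∑ S ∈ E.powerset, p ^ S.card * (1 - p) ^ (E.card - S.card) * f S

theorem subsetExp_pow_card (p c : ℝ) (E : Finset α) :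
    subsetExp p E (fun S => c ^ S.card) = (c * p + (1 - p)) ^ E.card := by
  rw [subsetExp, ← Finset.sum_pow_mul_eq_add_pow]
  refine Finset.sum_congr rfl fun S _ => ?_
  rw [mul_pow]
  ring

theorem subsetExp_one (p : ℝ) (E : Finset α) : subsetExp p E (fun _ => 1) = 1 := by
  simpa using subsetExp_pow_card p 1 E

theorem subsetExp_nonneg {p : ℝ} (h0 : 0 ≤ p) (h1 : p ≤ 1) (E : Finset α) {f : Finset α → ℝ}
    (hf : ∀ S, 0 ≤ f S) : 0 ≤ subsetExp p E f :=
  Finset.sum_nonneg fun S _ => mul_nonneg (mul_nonneg (pow_nonneg h0 _)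
    (pow_nonneg (by linarith) _)) (hf S)

theorem subsetExp_const_mul (p c : ℝ) (E : Finset α) (f : Finset α → ℝ) :
    subsetExp p E (fun S => c * f S) = c * subsetExp p E f := by
  rw [subsetExp, subsetExp, Finset.mul_sum]
  exact Finset.sum_congr rfl fun S _ => mul_left_comm _ _ _

variable [DecidableEq α]

theorem subsetExp_union (p : ℝ) {A B : Finset α} (h : Disjoint A B) (f g : Finset α → ℝ) :
    subsetExp p (A ∪ B) (fun S => f (S ∩ A) * g (S ∩ B))
      = subsetExp p A f * subsetExp p B g := by
  unfold subsetExp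
  rw [Finset.sum_mul_sum, ← Finset.sum_product']
  refine Finset.sum_nbij' (fun S => (S ∩ A, S ∩ B)) (fun z => z.1 ∪ z.2) ?_ ?_ ?_ ?_ ?_
  · intro S _
    exact Finset.mem_product.2 ⟨Finset.mem_powerset.2 Finset.inter_subset_right,
      Finset.mem_powerset.2 Finset.inter_subset_right⟩
  · intro z hz
    rw [Finset.mem_product, Finset.mem_powerset, Finset.mem_powerset] at hz
    exact Finset.mem_powerset.2 (Finset.union_subset_union hz.1 hz.2)
  · intro S hS
    rw [Finset.mem_powerset] at hS
    simp only
    rw [← Finset.inter_union_distrib_left, Finset.inter_eq_left.2 hS]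
  · intro z hz
    rw [Finset.mem_product, Finset.mem_powerset, Finset.mem_powerset] at hz
    have h1 : z.2 ∩ A = ∅ := Finset.disjoint_iff_inter_eq_empty.1
      (h.symm.mono_left hz.2)
    have h2 : z.1 ∩ B = ∅ := Finset.disjoint_iff_inter_eq_empty.1 (h.mono_left hz.1)
    rw [Finset.union_inter_distrib_right, Finset.union_inter_distrib_right, h1, h2,
      Finset.inter_eq_left.2 hz.1, Finset.inter_eq_left.2 hz.2, Finset.union_empty,
      Finset.empty_union]
  · intro S hS
    rw [Finset.mem_powerset] at hS
    have hc : S.card = (S ∩ A).card + (S ∩ B).card := by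
      rw [← Finset.card_union_of_disjoint (h.mono Finset.inter_subset_right
        Finset.inter_subset_right), ← Finset.inter_union_distrib_left, Finset.inter_eq_left.2 hS]
    have hA := Finset.card_le_card (Finset.inter_subset_right (s₁ := S) (s₂ := A))
    have hB := Finset.card_le_card (Finset.inter_subset_right (s₁ := S) (s₂ := B))
    rw [Finset.card_union_of_disjoint h, show A.card + B.card - S.card
      = (A.card - (S ∩ A).card) + (B.card - (S ∩ B).card) by omega, hc, pow_add, pow_add]
    ring

theorem subsetExp_biUnion (p : ℝ) {ι : Type*} [DecidableEq ι] (s : Finset ι) (E : ι → Finset α)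
    (f : ι → Finset α → ℝ) (h : ∀ i ∈ s, ∀ j ∈ s, i ≠ j → Disjoint (E i) (E j)) :
    subsetExp p (s.biUnion E) (fun S => ∏ i ∈ s, f i (S ∩ E i))
      = ∏ i ∈ s, subsetExp p (E i) (f i) := by
  induction s using Finset.induction_on with
  | empty => simpa using subsetExp_one p (∅ : Finset α)
  | insert i s hi ih =>
    have hd : Disjoint (E i) (s.biUnion E) := by
      rw [Finset.disjoint_biUnion_right]
      intro j hj
      exact h i (Finset.mem_insert_self _ _) j (Finset.mem_insert_of_mem hj)
        (by rintro rfl; exact hi hj)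
    rw [Finset.prod_insert hi, ← ih fun j hj k hk => h j (Finset.mem_insert_of_mem hj) k
      (Finset.mem_insert_of_mem hk), Finset.biUnion_insert, ← subsetExp_union p hd]
    refine Finset.sum_congr rfl fun S _ => ?_
    beta_reduce
    rw [Finset.prod_insert hi]
    congr 2
    refine Finset.prod_congr rfl fun j hj => ?_
    rw [Finset.inter_assoc, Finset.inter_eq_right.2 (Finset.subset_biUnion_of_mem E hj)]

theorem subsetExp_mono_set (p : ℝ) {A E : Finset α} (h : A ⊆ E) (f : Finset α → ℝ) :
    subsetExp p E (fun S => f (S ∩ A)) = subsetExp p A f := by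
  have := subsetExp_union p (Finset.disjoint_sdiff (s := A) (t := E)) f (fun _ => 1)
  rw [Finset.union_sdiff_of_subset h, subsetExp_one, mul_one] at this
  simpa using this

end SubsetExpectation

theorem prG_le_subsetExp {n : ℕ} {p : ℝ} (h0 : 0 ≤ p) (h1 : p ≤ 1)
    (Q : SimpleGraph (Fin n) → Prop) (f : Finset (Sym2 (Fin n)) → ℝ) (hf : ∀ S, 0 ≤ f S)
    (hQ : ∀ S ⊆ allEdges n, Q (SimpleGraph.fromEdgeSet (S : Set (Sym2 (Fin n)))) → 1 ≤ f S) :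
    prG n p Q ≤ subsetExp p (allEdges n) f := by
  refine Finset.sum_le_sum fun S hS => ?_
  have hw : 0 ≤ p ^ S.card * (1 - p) ^ ((allEdges n).card - S.card) :=
    mul_nonneg (pow_nonneg h0 _) (pow_nonneg (by linarith) _)
  by_cases h : Q (SimpleGraph.fromEdgeSet (S : Set (Sym2 (Fin n))))
  · rw [Set.indicator_of_mem (by exact h)]
    exact le_mul_of_one_le_right hw (hQ S (Finset.mem_powerset.1 hS) h)
  · rw [Set.indicator_of_notMem (by exact h)]
    exact mul_nonneg hw (hf S)

theorem subsetExp_card_le_three {α : Type*} {p : ℝ} (h0 : 0 ≤ p) (h1 : p ≤ 1)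
    (E : Finset α) :
    subsetExp p E (fun S => if S.card ≤ 3 then 1 / 2 else 1)
      ≤ 1 - 1 / 2 * (E.card.choose 3 * p ^ 3 * (1 - p) ^ (E.card - 3)) := by
  have hw : ∀ S : Finset α, 0 ≤ p ^ S.card * (1 - p) ^ (E.card - S.card) := fun S =>
    mul_nonneg (pow_nonneg h0 _) (pow_nonneg (by linarith) _)
  have e1 : subsetExp p E (fun S => if S.card ≤ 3 then 1 / 2 else 1)
      = 1 - 1 / 2 * ∑ S ∈ E.powerset, if S.card ≤ 3 then
        p ^ S.card * (1 - p) ^ (E.card - S.card) else 0 := by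
    have hone := subsetExp_one p E
    rw [subsetExp] at hone
    rw [subsetExp, eq_sub_iff_add_eq, Finset.mul_sum, ← Finset.sum_add_distrib]
    refine (Finset.sum_congr rfl fun S _ => ?_).trans hone
    split_ifs <;> ring
  have e2 : E.card.choose 3 * p ^ 3 * (1 - p) ^ (E.card - 3)
      ≤ ∑ S ∈ E.powerset, if S.card ≤ 3 then
        p ^ S.card * (1 - p) ^ (E.card - S.card) else 0 := by
    calc _ = ∑ S ∈ E.powersetCard 3, (if S.card ≤ 3 then
          p ^ S.card * (1 - p) ^ (E.card - S.card) else 0) := by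
          rw [Finset.sum_congr rfl fun S hS => by
            rw [(Finset.mem_powersetCard.1 hS).2, if_pos le_rfl], Finset.sum_const,
            Finset.card_powersetCard, nsmul_eq_mul, mul_assoc]
      _ ≤ _ := by
          refine Finset.sum_le_sum_of_subset_of_nonneg (fun S hS => ?_) fun S _ _ => ?_
          · exact Finset.mem_powerset.2 (Finset.mem_powersetCard.1 hS).1
          · split_ifs
            exacts [hw S, le_rfl]
  rw [e1]
  linarith

section LowDegree

variable {n : ℕ}

/-- The edges between the vertex `z` and the complement of `Z`. -/
def outEdges (Z : Finset (Fin n)) (z : Fin n) : Finset (Sym2 (Fin n)) :=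
  Zᶜ.image fun x => s(z, x)

/-- The edges inside `Z`. -/
def innerEdges (Z : Finset (Fin n)) : Finset (Sym2 (Fin n)) :=
  Z.offDiag.image fun x => s(x.1, x.2)

theorem card_outEdges (Z : Finset (Fin n)) (z : Fin n) :
    (outEdges Z z).card = n - Z.card := by
  rw [outEdges, Finset.card_image_of_injective _ fun x y h => Sym2.congr_right.1 h,
    Finset.card_compl, Fintype.card_fin]

theorem card_innerEdges_le (Z : Finset (Fin n)) : (innerEdges Z).card ≤ Z.card ^ 2 := by
  refine Finset.card_image_le.trans ?_
  rw [Finset.offDiag_card, sq]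
  exact Nat.sub_le _ _

theorem disjoint_outEdges {Z : Finset (Fin n)} {z z' : Fin n} (hz : z ∈ Z)
    (h : z ≠ z') : Disjoint (outEdges Z z) (outEdges Z z') := by
  rw [Finset.disjoint_left]
  intro e he he'
  obtain ⟨x, hx, rfl⟩ := Finset.mem_image.1 he
  obtain ⟨y, hy, hxy⟩ := Finset.mem_image.1 he'
  rw [Finset.mem_compl] at hx hy
  rcases Sym2.eq_iff.1 hxy with ⟨h1, _⟩ | ⟨_, h2⟩
  · exact h h1.symm
  · exact hy (h2 ▸ hz)

theorem disjoint_outEdges_innerEdges (Z : Finset (Fin n)) (z : Fin n) :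
    Disjoint (outEdges Z z) (innerEdges Z) := by
  rw [Finset.disjoint_left]
  intro e he he'
  obtain ⟨x, hx, rfl⟩ := Finset.mem_image.1 he
  obtain ⟨y, hy, hxy⟩ := Finset.mem_image.1 he'
  rw [Finset.mem_compl] at hx
  rw [Finset.mem_offDiag] at hy
  rcases Sym2.eq_iff.1 hxy with ⟨_, h1⟩ | ⟨h1, _⟩
  · exact hx (h1 ▸ hy.2.1)
  · exact hx (h1 ▸ hy.1)

theorem outEdges_subset {Z : Finset (Fin n)} {z : Fin n} (hz : z ∈ Z) :
    outEdges Z z ⊆ allEdges n := by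
  intro e he
  obtain ⟨x, hx, rfl⟩ := Finset.mem_image.1 he
  rw [Finset.mem_compl] at hx
  refine Finset.mem_filter.2 ⟨Finset.mem_univ _, fun h => hx ?_⟩
  rw [Sym2.mk_isDiag_iff] at h
  exact h ▸ hz

theorem innerEdges_subset (Z : Finset (Fin n)) : innerEdges Z ⊆ allEdges n := by
  intro e he
  obtain ⟨x, hx, rfl⟩ := Finset.mem_image.1 he
  refine Finset.mem_filter.2 ⟨Finset.mem_univ _, fun h => ?_⟩
  rw [Sym2.mk_isDiag_iff] at h
  exact (Finset.mem_offDiag.1 hx).2.2 h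

/-- A vertex of `Z` with few edges leaving `Z` has small degree unless it lies on an edge
inside `Z`. -/
theorem card_few_outEdges_le (Z : Finset (Fin n)) (S : Finset (Sym2 (Fin n))) (k : ℕ) :
    (Z.filter fun z => (S ∩ outEdges Z z).card ≤ k).card
      ≤ {v | v ∈ Z ∧ {u | (SimpleGraph.fromEdgeSet (S : Set (Sym2 (Fin n)))).Adj v u}.ncard
        ≤ k}.ncard + 2 * (S ∩ innerEdges Z).card := by
  set L := {v | v ∈ Z ∧ {u | (SimpleGraph.fromEdgeSet (S : Set (Sym2 (Fin n)))).Adj v u}.ncard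
    ≤ k} with hL
  have hT : ((S ∩ innerEdges Z).biUnion Sym2.toFinset).card ≤ (S ∩ innerEdges Z).card * 2 :=
    Finset.card_biUnion_le_card_mul _ _ 2 fun e _ => by
      by_cases h : e.IsDiag
      · rw [Sym2.card_toFinset_of_isDiag _ h]
        norm_num
      · rw [Sym2.card_toFinset_of_not_isDiag _ h]
  have hsub : ((Z.filter fun z => (S ∩ outEdges Z z).card ≤ k : Finset (Fin n)) : Set (Fin n))
      ⊆ L ∪ ((S ∩ innerEdges Z).biUnion Sym2.toFinset : Finset (Fin n)) := by
    intro z hz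
    rw [Finset.mem_coe, Finset.mem_filter] at hz
    by_cases hzT : z ∈ (S ∩ innerEdges Z).biUnion Sym2.toFinset
    · exact Or.inr hzT
    refine Or.inl ⟨hz.1, le_trans ?_ hz.2⟩
    rw [← Set.ncard_coe_finset]
    refine Set.ncard_le_ncard_of_injOn (fun x => s(z, x)) (fun u hu => ?_)
      (fun x _ y _ h => Sym2.congr_right.1 h) (Finset.finite_toSet _)
    rw [Set.mem_ofPred_eq, SimpleGraph.fromEdgeSet_adj] at hu
    have huZ : u ∉ Z := by
      intro huZ
      refine hzT (Finset.mem_biUnion.2 ⟨s(z, u), Finset.mem_inter.2 ⟨hu.1, ?_⟩, by simp⟩)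
      exact Finset.mem_image.2 ⟨(z, u), Finset.mem_offDiag.2 ⟨hz.1, huZ, hu.2⟩, rfl⟩
    exact Finset.mem_coe.2 (Finset.mem_inter.2 ⟨hu.1,
      Finset.mem_image.2 ⟨u, Finset.mem_compl.2 huZ, rfl⟩⟩)
  rw [← Set.ncard_coe_finset]
  refine (Set.ncard_le_ncard hsub (Set.toFinite _)).trans ((Set.ncard_union_le _ _).trans ?_)
  rw [Set.ncard_coe_finset]
  omega

theorem prG_low_degree_le {p : ℝ} (h0 : 0 ≤ p) (h1 : p ≤ 1) (Z : Finset (Fin n)) (y : ℕ) :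
    prG n p (fun G => {v | v ∈ Z ∧ {u | G.Adj v u}.ncard ≤ 3}.ncard ≤ y)
      ≤ 2 ^ y * ((1 - 1 / 2 * ((n - Z.card).choose 3 * p ^ 3 * (1 - p) ^ (n - Z.card - 3)))
        ^ Z.card * (1 + 3 * p) ^ Z.card ^ 2) := by
  let h : Finset (Sym2 (Fin n)) → ℝ := fun S => if S.card ≤ 3 then 1 / 2 else 1
  have hh : ∀ S, 0 ≤ h S := fun S => by
    simp only [h]
    split_ifs <;> norm_num
  let A := Z.biUnion (outEdges Z)
  have hA : Disjoint A (innerEdges Z) :=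
    (Finset.disjoint_biUnion_left _ _ _).2 fun z _ => disjoint_outEdges_innerEdges Z z
  have hAE : A ∪ innerEdges Z ⊆ allEdges n := Finset.union_subset
    (Finset.biUnion_subset.2 fun z hz => outEdges_subset hz) (innerEdges_subset Z)
  let f : Finset (Sym2 (Fin n)) → ℝ := fun S =>
    (∏ z ∈ Z, h (S ∩ outEdges Z z)) * 4 ^ (S ∩ innerEdges Z).card
  have hf : ∀ S, 0 ≤ f S := fun S =>
    mul_nonneg (Finset.prod_nonneg fun z _ => hh _) (by positivity)
  refine (prG_le_subsetExp h0 h1 _ (fun S => 2 ^ y * f S)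
    (fun S => mul_nonneg (by positivity) (hf S)) fun S _ hS => ?_).trans ?_
  · have hc := (card_few_outEdges_le Z S 3).trans (Nat.add_le_add_right hS _)
    have hprod : ∏ z ∈ Z, h (S ∩ outEdges Z z)
        = (1 / 2) ^ (Z.filter fun z => (S ∩ outEdges Z z).card ≤ 3).card := by
      rw [Finset.prod_ite, Finset.prod_const, Finset.prod_const_one, mul_one]
    simp only [f]
    rw [hprod, one_div, inv_pow, show (4 : ℝ) = 2 ^ 2 by norm_num, ← pow_mul, mul_left_comm,
      ← pow_add, inv_mul_eq_div, one_le_div (by positivity)]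
    exact pow_le_pow_right₀ (by norm_num) hc
  · rw [subsetExp_const_mul]
    refine mul_le_mul_of_nonneg_left ?_ (by positivity)
    have e1 : subsetExp p (allEdges n) f = subsetExp p (A ∪ innerEdges Z) f := by
      rw [← subsetExp_mono_set p hAE]
      refine Finset.sum_congr rfl fun S _ => ?_
      simp only [f]
      congr 2
      · refine Finset.prod_congr rfl fun z hz => ?_
        rw [Finset.inter_assoc, Finset.inter_eq_right.2
          ((Finset.subset_biUnion_of_mem _ hz).trans Finset.subset_union_left)]
      · rw [Finset.inter_assoc, Finset.inter_eq_right.2 Finset.subset_union_right]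
    have e2 : subsetExp p (A ∪ innerEdges Z) f
        = (∏ z ∈ Z, subsetExp p (outEdges Z z) h)
          * subsetExp p (innerEdges Z) (fun S => 4 ^ S.card) := by
      rw [← subsetExp_biUnion p Z (outEdges Z) (fun _ => h)
        fun z hz z' _ hne => disjoint_outEdges hz hne, ← subsetExp_union p hA]
      refine Finset.sum_congr rfl fun S _ => ?_
      simp only [f]
      congr 2
      refine Finset.prod_congr rfl fun z hz => ?_
      rw [Finset.inter_assoc, Finset.inter_eq_right.2 (Finset.subset_biUnion_of_mem _ hz)]
    rw [e1, e2, subsetExp_pow_card]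
    refine mul_le_mul ?_ ?_ (pow_nonneg (by linarith) _) ?_
    · rw [← Finset.prod_const]
      refine Finset.prod_le_prod (fun z _ => subsetExp_nonneg h0 h1 _ hh) fun z _ => ?_
      have := subsetExp_card_le_three h0 h1 (outEdges Z z)
      rwa [card_outEdges] at this
    · rw [show 4 * p + (1 - p) = 1 + 3 * p by ring]
      exact pow_le_pow_right₀ (by linarith) (card_innerEdges_le Z)
    · rw [← Finset.prod_const]
      refine Finset.prod_nonneg fun z _ => ?_
      have := subsetExp_card_le_three h0 h1 (outEdges Z z)
      rw [card_outEdges] at this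
      exact (subsetExp_nonneg h0 h1 _ hh).trans this

end LowDegree

section LowDegreeAsymptotics

theorem tendsto_pow_mul_exp_neg_mul (k : ℕ) {c : ℝ} (hc : 0 < c) :
    Tendsto (fun n : ℕ => (n : ℝ) ^ k * Real.exp (-(c * n))) atTop (nhds 0) := by
  have h := tendsto_pow_const_mul_const_pow_of_abs_lt_one (r := Real.exp (-c)) k (by
    rw [abs_of_pos (Real.exp_pos _), Real.exp_lt_one_iff]
    linarith)
  refine h.congr fun n => ?_
  rw [← Real.exp_nat_mul]
  ring_nf

theorem choose_three_mul_ge {n m : ℕ} {d : ℝ} (hd : 0 < d) (hdn : d ≤ n) (hn : 80 ≤ n)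
    (hm : 40 * m ≤ n) (he : 0.9 * Real.exp (-d) ≤ (1 - d / n) ^ n) :
    d ^ 3 * Real.exp (-d) / 8
      ≤ (n - m).choose 3 * (d / n) ^ 3 * (1 - d / n) ^ (n - m - 3) := by
  have hn0 : (0 : ℝ) < n := hd.trans_le hdn
  have hp1 : d / n ≤ 1 := (div_le_one hn0).2 hdn
  have hp0 : 0 < d / n := div_pos hd hn0
  have h1 : 0.9 * Real.exp (-d) ≤ (1 - d / n) ^ (n - m - 3) :=
    he.trans (pow_le_pow_of_le_one (by linarith) (by linarith) (by omega))
  have h2 : (0.95 * n : ℝ) ^ 3 ≤ 6 * (n - m).choose 3 := by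
    have h3 := Nat.pow_sub_le_descFactorial (n - m) 3
    rw [Nat.descFactorial_eq_factorial_mul_choose] at h3
    have h4 : 95 * n ≤ 100 * (n - m + 1 - 3) := by omega
    have h4' : (95 * n : ℝ) ≤ 100 * ((n - m + 1 - 3 : ℕ) : ℝ) := by exact_mod_cast h4
    have h3' : (((n - m + 1 - 3 : ℕ) : ℝ)) ^ 3 ≤ 6 * (n - m).choose 3 := by exact_mod_cast h3
    refine le_trans (pow_le_pow_left₀ (by positivity) ?_ 3) h3'
    linarith
  have h5 : 0.95 ^ 3 / 6 * d ^ 3 ≤ (n - m).choose 3 * (d / n) ^ 3 := by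
    rw [div_pow, mul_div_assoc', le_div_iff₀ (by positivity)]
    have := mul_le_mul_of_nonneg_right h2 (pow_pos hd 3).le
    linarith [this]
  calc d ^ 3 * Real.exp (-d) / 8 ≤ (0.95 ^ 3 / 6 * d ^ 3) * (0.9 * Real.exp (-d)) := by
        have : 0 < d ^ 3 * Real.exp (-d) := by positivity
        norm_num
        linarith
    _ ≤ _ := mul_le_mul h5 h1 (by positivity) (by positivity)

theorem prG_low_degree_le_exp {n y : ℕ} {d : ℝ} (hd : 0 < d) (hdn : d ≤ n) (hn : 80 ≤ n)
    (he : 0.9 * Real.exp (-d) ≤ (1 - d / n) ^ n) (Z : Finset (Fin n)) (hm : 40 * Z.card ≤ n)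
    (hm' : 300 * d * Z.card ≤ d ^ 3 * Real.exp (-d) * n)
    (hy : y ≤ 0.03 * (d ^ 3 * Real.exp (-d)) * Z.card) :
    prG n (d / n) (fun G => {v | v ∈ Z ∧ {u | G.Adj v u}.ncard ≤ 3}.ncard ≤ y)
      ≤ Real.exp (-(0.03 * (d ^ 3 * Real.exp (-d)) * Z.card)) := by
  have hn0 : (0 : ℝ) < n := hd.trans_le hdn
  have hp1 : d / n ≤ 1 := (div_le_one hn0).2 hdn
  have hp0 : 0 < d / n := div_pos hd hn0
  have hq := choose_three_mul_ge hd hdn hn hm he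
  refine (prG_low_degree_le hp0.le hp1 Z y).trans ?_
  set κ : ℝ := d ^ 3 * Real.exp (-d) with hκ
  have hκ0 : 0 < κ := by positivity
  set q := (n - Z.card).choose 3 * (d / n) ^ 3 * (1 - d / n) ^ (n - Z.card - 3) with hqdef
  have b1 : (2 : ℝ) ^ y ≤ Real.exp (0.7 * y) := by
    rw [mul_comm, Real.exp_nat_mul]
    refine pow_le_pow_left₀ (by norm_num) ?_ _
    rw [← Real.log_le_iff_le_exp (by norm_num)]
    linarith [Real.log_two_lt_d9]
  have b2 : (1 - 1 / 2 * q) ^ Z.card ≤ Real.exp (-(κ / 16) * Z.card) := by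
    rw [mul_comm _ (Z.card : ℝ), Real.exp_nat_mul]
    refine pow_le_pow_left₀ ?_ ?_ _
    · have := subsetExp_card_le_three hp0.le hp1 (Finset.range (n - Z.card))
      rw [Finset.card_range] at this
      refine (subsetExp_nonneg hp0.le hp1 _ fun S => ?_).trans this
      split_ifs <;> norm_num
    · linarith [Real.add_one_le_exp (-(κ / 16))]
  have b3 : (1 + 3 * (d / n)) ^ Z.card ^ 2 ≤ Real.exp (0.01 * κ * Z.card) := by
    calc (1 + 3 * (d / n)) ^ Z.card ^ 2 ≤ Real.exp (3 * (d / n)) ^ Z.card ^ 2 := by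
          refine pow_le_pow_left₀ (by positivity) ?_ _
          linarith [Real.add_one_le_exp (3 * (d / n))]
      _ = Real.exp (3 * (d / n) * Z.card * Z.card) := by
          rw [← Real.exp_nat_mul]
          push_cast
          ring_nf
      _ ≤ _ := by
          refine Real.exp_le_exp.2 (mul_le_mul_of_nonneg_right ?_ (Nat.cast_nonneg _))
          rw [mul_div_assoc', div_mul_eq_mul_div, div_le_iff₀ hn0]
          linarith
  have hq2 : 0 ≤ (1 - 1 / 2 * q) ^ Z.card := by
    have := subsetExp_card_le_three hp0.le hp1 (Finset.range (n - Z.card))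
    rw [Finset.card_range] at this
    refine pow_nonneg ((subsetExp_nonneg hp0.le hp1 _ fun S => ?_).trans this) _
    split_ifs <;> norm_num
  calc _ ≤ Real.exp (0.7 * y) * (Real.exp (-(κ / 16) * Z.card)
        * Real.exp (0.01 * κ * Z.card)) := by gcongr
    _ = Real.exp (0.7 * y + (-(κ / 16) * Z.card + 0.01 * κ * Z.card)) := by
        rw [Real.exp_add, Real.exp_add]
    _ ≤ _ := by
        refine Real.exp_le_exp.2 ?_
        have : 0 ≤ κ * Z.card := by positivity
        linarith

theorem exists_block_of_ncard_lt {n K y : ℕ} (L : Set (Fin n)) (h : L.ncard < K * (y + 1))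
    (Z : ℕ → Finset (Fin n)) (hZ : ∀ r s, r ≠ s → Disjoint (Z r) (Z s)) :
    ∃ r ∈ Finset.range K, {v | v ∈ Z r ∧ v ∈ L}.ncard ≤ y := by
  classical
  by_contra hcon
  push Not at hcon
  refine absurd h (not_lt.2 ?_)
  have h1 := Finset.card_nsmul_le_sum (Finset.range K)
    (fun r => ((Z r).filter fun v => v ∈ L).card) (y + 1) fun r hr => by
      have := hcon r hr
      rw [← Set.ncard_coe_finset, Finset.coe_filter]
      exact this
  rw [Finset.card_range, smul_eq_mul] at h1
  refine h1.trans ?_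
  rw [← Finset.card_biUnion fun r _ s _ hrs => (hZ r s hrs).mono (Finset.filter_subset _ _)
    (Finset.filter_subset _ _), ← Set.ncard_coe_finset]
  refine Set.ncard_le_ncard (fun v hv => ?_) (Set.toFinite _)
  obtain ⟨r, _, hv⟩ := Finset.mem_biUnion.1 (Finset.mem_coe.1 hv)
  exact (Finset.mem_filter.1 hv).2

theorem prG_few_low_degree_le {n K m y : ℕ} {d : ℝ} (hd : 0 < d) (hdn : d ≤ n) (hn : 80 ≤ n)
    (he : 0.9 * Real.exp (-d) ≤ (1 - d / n) ^ n) (hmK : K * m ≤ n) (hm : 40 * m ≤ n)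
    (hm' : 300 * d * m ≤ d ^ 3 * Real.exp (-d) * n)
    (hy : y ≤ 0.03 * (d ^ 3 * Real.exp (-d)) * m) :
    prG n (d / n) (fun G => {v | {u | G.Adj v u}.ncard ≤ 3}.ncard < K * (y + 1))
      ≤ K * Real.exp (-(0.03 * (d ^ 3 * Real.exp (-d)) * m)) := by
  have hn0 : (0 : ℝ) < n := hd.trans_le hdn
  let Z : ℕ → Finset (Fin n) := fun r => Finset.univ.filter fun v =>
    (v : ℕ) ∈ Finset.Ico (r * m) ((r + 1) * m)
  have hZc : ∀ r ∈ Finset.range K, (Z r).card = m := by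
    intro r hr
    have hrK : (r + 1) * m ≤ n :=
      (Nat.mul_le_mul_right m (Nat.succ_le_of_lt (Finset.mem_range.1 hr))).trans hmK
    have : (Z r).map Fin.valEmbedding = Finset.Ico (r * m) ((r + 1) * m) := by
      ext i
      simp only [Z, Finset.mem_map, Finset.mem_filter, Finset.mem_univ, true_and,
        Fin.valEmbedding_apply]
      constructor
      · rintro ⟨v, hv, rfl⟩
        exact hv
      · intro hi
        exact ⟨⟨i, (Finset.mem_Ico.1 hi).2.trans_le hrK⟩, hi, rfl⟩
    rw [← Finset.card_map Fin.valEmbedding, this, Nat.card_Ico, Nat.succ_mul,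
      Nat.add_sub_cancel_left]
  have hZd : ∀ r s, r ≠ s → Disjoint (Z r) (Z s) := by
    intro r s hrs
    rw [Finset.disjoint_left]
    intro v hr hs
    have h1 := Finset.mem_Ico.1 (Finset.mem_filter.1 hr).2
    have h2 := Finset.mem_Ico.1 (Finset.mem_filter.1 hs).2
    have h3 := Nat.lt_of_mul_lt_mul_right (h1.1.trans_lt h2.2)
    have h4 := Nat.lt_of_mul_lt_mul_right (h2.1.trans_lt h1.2)
    omega
  refine (prG_exists_le (div_pos hd hn0).le ((div_le_one hn0).2 hdn) (Finset.range K) _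
    (fun r G => {v | v ∈ Z r ∧ {u | G.Adj v u}.ncard ≤ 3}.ncard ≤ y)
    fun G hG => exists_block_of_ncard_lt _ hG Z hZd).trans ?_
  calc _ ≤ ∑ r ∈ Finset.range K, Real.exp (-(0.03 * (d ^ 3 * Real.exp (-d)) * m)) := by
        refine Finset.sum_le_sum fun r hr => ?_
        have h := hZc r hr
        rw [← h] at hm hm' hy ⊢
        exact prG_low_degree_le_exp hd hdn hn he (Z r) hm hm' hy
    _ = _ := by rw [Finset.sum_const, Finset.card_range, nsmul_eq_mul]

theorem tendsto_mul_prG_few_low_degree {d : ℝ} (hd : 0 < d) :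
    Tendsto (fun n : ℕ => (n : ℝ) * prG n (d / n) (fun G =>
      ({v | {u | G.Adj v u}.ncard ≤ 3}.ncard : ℝ) < 0.02 * (d ^ 3 * Real.exp (-d)) * n))
      atTop (nhds 0) := by
  set κ : ℝ := d ^ 3 * Real.exp (-d) with hκ
  have hκ0 : 0 < κ := by positivity
  obtain ⟨K₀, hK₀⟩ := exists_nat_ge (300 * d / κ)
  obtain ⟨K, hK40, hK⟩ : ∃ K : ℕ, 40 ≤ K ∧ 300 * d / κ ≤ K :=
    ⟨max 40 K₀, le_max_left _ _, hK₀.trans (by exact_mod_cast le_max_right _ _)⟩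
  rw [div_le_iff₀ hκ0] at hK
  have hmT : Tendsto (fun n : ℕ => n / K) atTop atTop := Nat.tendsto_div_const_atTop (by omega)
  have hlim := ((tendsto_pow_mul_exp_neg_mul 1 (c := 0.03 * κ) (by positivity)).const_mul
    (2 * K ^ 2 : ℝ)).comp hmT
  rw [mul_zero] at hlim
  have hexp : ∀ᶠ n : ℕ in atTop, 0.9 * Real.exp (-d) < (1 + -d / n) ^ n := by
    refine (Real.tendsto_one_add_div_pow_exp (-d)).eventually (lt_mem_nhds ?_)
    linarith [Real.exp_pos (-d)]
  refine squeeze_zero' ?_ ?_ hlim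
  · filter_upwards [tendsto_natCast_atTop_atTop.eventually_ge_atTop d] with n hdn
    have hn : (0 : ℝ) < n := hd.trans_le hdn
    exact mul_nonneg hn.le (prG_nonneg (div_pos hd hn).le ((div_le_one hn).2 hdn) _)
  · filter_upwards [tendsto_natCast_atTop_atTop.eventually_ge_atTop d, eventually_ge_atTop (3 * K),
      hexp] with n hdn hn3 he
    have hn : (0 : ℝ) < n := hd.trans_le hdn
    rw [neg_div, ← sub_eq_add_neg] at he
    have hmK : K * (n / K) ≤ n := Nat.mul_div_le n K
    have hlt : n < K * (n / K) + K := Nat.lt_mul_div_succ n (by omega)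
    have hm1 : 1 ≤ n / K := (Nat.one_le_div_iff (by omega)).2 (by omega)
    simp only [Function.comp_apply, pow_one]
    generalize hmdef : n / K = m at hmK hlt hm1
    have hm40 : 40 * m ≤ n := (Nat.mul_le_mul_right m hK40).trans hmK
    have hmKR : (K * m : ℝ) ≤ n := by exact_mod_cast hmK
    have hltR : (n : ℝ) < K * m + K := by exact_mod_cast hlt
    have hn3R : (3 * K : ℝ) ≤ n := by exact_mod_cast hn3
    have hm1R : (1 : ℝ) ≤ m := by exact_mod_cast hm1
    have hK1 : (0 : ℝ) ≤ K := Nat.cast_nonneg _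
    have hy := Nat.floor_le (show 0 ≤ 0.03 * κ * m by positivity)
    have hy' := Nat.lt_floor_add_one (0.03 * κ * m)
    have hb := prG_few_low_degree_le (K := K) hd hdn (by omega) he.le hmK hm40 (by
      calc 300 * d * m ≤ K * κ * m := by gcongr
        _ = κ * (K * m) := by ring
        _ ≤ κ * n := by gcongr) hy
    have hmono : prG n (d / n) (fun G =>
        ({v | {u | G.Adj v u}.ncard ≤ 3}.ncard : ℝ) < 0.02 * κ * n)
        ≤ prG n (d / n) (fun G => {v | {u | G.Adj v u}.ncard ≤ 3}.ncard
          < K * (⌊0.03 * κ * m⌋₊ + 1)) := by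
      refine prG_mono (div_pos hd hn).le ((div_le_one hn).2 hdn) fun G hG => ?_
      rw [← Nat.cast_lt (α := ℝ)]
      refine hG.trans_le ?_
      push_cast
      calc 0.02 * κ * n ≤ 0.03 * κ * (K * m) := by nlinarith
        _ = K * (0.03 * κ * m) := by ring
        _ ≤ _ := by gcongr
    calc n * prG n (d / n) (fun G => ({v | {u | G.Adj v u}.ncard ≤ 3}.ncard : ℝ) < 0.02 * κ * n)
        ≤ (2 * K * m) * (K * Real.exp (-(0.03 * κ * m))) := by
          refine mul_le_mul ?_ (hmono.trans hb) (prG_nonneg (div_pos hd hn).le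
            ((div_le_one hn).2 hdn) _) (by positivity)
          nlinarith
      _ = _ := by ring

end LowDegreeAsymptotics

section Separator

theorem four_le_ncard_of_mem_strongCore {V : Type*} [Finite V] {G : SimpleGraph V} {v : V}
    (hv : v ∈ strongCore G 4) : 4 ≤ {u | G.Adj v u}.ncard := by
  obtain ⟨T, hT, hvT⟩ := hv
  exact (hT v (Or.inl hvT)).trans (Set.ncard_le_ncard (fun u hu => hu.2) (Set.toFinite _))

theorem not_adj_strongCore {V : Type*} {G : SimpleGraph V} {v u : V}
    (hv : v ∉ strongCore G 4) (hv' : v ∉ strongBlue G 4) (hu : u ∈ strongCore G 4) :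
    ¬ G.Adj v u := fun h => hv' ⟨hv, u, hu, h⟩

/-- A small strong blue set yields a small separator between the strong core and the remaining
vertices. -/
theorem exists_separator {n b : ℕ} (G : SimpleGraph (Fin n)) (hS : n ≤ 2 * (strongCore G 4).ncard)
    (hB : (strongBlue G 4).ncard ≤ b) (hb : 2 * b ≤ n) :
    ∃ W B : Finset (Fin n), {v | {u | G.Adj v u}.ncard ≤ 3}.ncard ≤ W.card + b ∧
      2 * W.card ≤ n ∧ B.card = b ∧ ∀ v ∈ W, ∀ u, u ∉ W ∪ B → ¬ G.Adj v u := by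
  classical
  set C := (strongCore G 4).toFinset with hC
  set D := (strongBlue G 4).toFinset with hD
  have hmC : ∀ v, v ∈ C ↔ v ∈ strongCore G 4 := fun v => Set.mem_toFinset
  have hmD : ∀ v, v ∈ D ↔ v ∈ strongBlue G 4 := fun v => Set.mem_toFinset
  rw [← Set.coe_toFinset (strongCore G 4), ← hC, Set.ncard_coe_finset] at hS
  rw [← Set.coe_toFinset (strongBlue G 4), ← hD, Set.ncard_coe_finset] at hB
  have hDC : Disjoint C D := Finset.disjoint_left.2 fun v hv hv' =>
    ((hmD v).1 hv').1 ((hmC v).1 hv)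
  have hW : (C ∪ D)ᶜ.card + (C.card + D.card) = n := by
    rw [← Finset.card_union_of_disjoint hDC, add_comm, Finset.card_add_card_compl,
      Fintype.card_fin]
  obtain ⟨B, hDB, hBC, hBb⟩ := Finset.exists_subsuperset_card_eq
    (Finset.subset_union_right : D ⊆ C ∪ D) (n := b) hB (by
      rw [Finset.card_union_of_disjoint hDC]
      omega)
  refine ⟨(C ∪ D)ᶜ, B, ?_, by omega, hBb, fun v hv u hu => ?_⟩
  · refine le_trans (b := ((C ∪ D)ᶜ ∪ D).card) ?_
      ((Finset.card_union_le _ _).trans (Nat.add_le_add_left hB _))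
    rw [← Set.ncard_coe_finset]
    refine Set.ncard_le_ncard (fun v hv => ?_) (Set.toFinite _)
    have hvC : v ∉ C := fun h => by
      have := four_le_ncard_of_mem_strongCore ((hmC v).1 h)
      rw [Set.mem_ofPred_eq] at hv
      omega
    by_cases hvD : v ∈ D <;> simp [hvC, hvD]
  · rw [Finset.mem_compl, Finset.mem_union, not_or] at hv
    rw [Finset.mem_union, not_or, Finset.mem_compl, not_not, Finset.mem_union] at hu
    have huC : u ∈ C := hu.1.resolve_right fun h => hu.2 (hDB h)
    exact not_adj_strongCore (fun h => hv.1 ((hmC v).2 h)) (fun h => hv.2 ((hmD v).2 h))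
      ((hmC u).1 huC)

theorem prG_no_edges_le {n : ℕ} {p : ℝ} (h0 : 0 ≤ p) (h1 : p ≤ 1) (W B : Finset (Fin n)) :
    prG n p (fun G => ∀ v ∈ W, ∀ u, u ∉ W ∪ B → ¬ G.Adj v u)
      ≤ (1 - p) ^ (W.card * (n - W.card - B.card)) := by
  let H := (W ×ˢ (W ∪ B)ᶜ).image fun z => s(z.1, z.2)
  have hH : H ⊆ allEdges n := by
    intro e he
    obtain ⟨z, hz, rfl⟩ := Finset.mem_image.1 he
    rw [Finset.mem_product, Finset.mem_compl] at hz
    refine Finset.mem_filter.2 ⟨Finset.mem_univ _, fun h => hz.2 ?_⟩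
    rw [Sym2.mk_isDiag_iff] at h
    exact Finset.mem_union_left _ (h ▸ hz.1)
  have hc : W.card * (n - W.card - B.card) ≤ H.card := by
    rw [Finset.card_image_of_injOn, Finset.card_product, Finset.card_compl, Fintype.card_fin,
      Nat.sub_sub]
    · exact Nat.mul_le_mul_left _ (Nat.sub_le_sub_left (Finset.card_union_le _ _) _)
    · rintro ⟨v, x⟩ hz ⟨v', x'⟩ hz' heq
      simp only [Finset.coe_product, Set.mem_prod, Finset.mem_coe, Finset.mem_compl,
        Finset.mem_union, not_or] at hz hz'
      rcases Sym2.eq_iff.1 heq with ⟨e1, e2⟩ | ⟨e1, e2⟩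
      · exact Prod.ext e1 e2
      · rw [show v = x' from e1] at hz
        exact absurd hz.1 hz'.2.1
  refine (prG_mono h0 h1 fun G hG => ?_).trans ((prG_cylinder_le h0 h1 ∅ H hH (by simp)).trans ?_)
  · refine ⟨by simp, fun e he => ?_⟩
    obtain ⟨z, hz, rfl⟩ := Finset.mem_image.1 he
    rw [Finset.mem_product, Finset.mem_compl] at hz
    exact hG z.1 hz.1 z.2 hz.2
  · rw [Finset.card_empty, pow_zero, one_mul]
    exact pow_le_pow_of_le_one (by linarith) (by linarith) hc

theorem prG_separator_le {n : ℕ} {p : ℝ} (h0 : 0 ≤ p) (h1 : p ≤ 1) (w b : ℕ) :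
    prG n p (fun G => ∃ W B : Finset (Fin n), W.card = w ∧ B.card = b ∧
      ∀ v ∈ W, ∀ u, u ∉ W ∪ B → ¬ G.Adj v u)
      ≤ n.choose w * n.choose b * (1 - p) ^ (w * (n - w - b)) := by
  refine (prG_exists_le h0 h1
    (Finset.powersetCard w Finset.univ ×ˢ Finset.powersetCard b Finset.univ) _
    (fun z G => ∀ v ∈ z.1, ∀ u, u ∉ z.1 ∪ z.2 → ¬ G.Adj v u) ?_).trans ?_
  · rintro G ⟨W, B, hW, hB, h⟩
    exact ⟨(W, B), Finset.mem_product.2 ⟨Finset.mem_powersetCard_univ.2 hW,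
      Finset.mem_powersetCard_univ.2 hB⟩, h⟩
  · calc _ ≤ ∑ z ∈ (Finset.powersetCard w Finset.univ ×ˢ Finset.powersetCard b Finset.univ :
          Finset (Finset (Fin n) × Finset (Fin n))), (1 - p) ^ (w * (n - w - b)) := by
          refine Finset.sum_le_sum fun z hz => ?_
          rw [Finset.mem_product, Finset.mem_powersetCard_univ,
            Finset.mem_powersetCard_univ] at hz
          rw [← hz.1, ← hz.2]
          exact prG_no_edges_le h0 h1 z.1 z.2
      _ = _ := by
          rw [Finset.sum_const, Finset.card_product, Finset.card_powersetCard,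
            Finset.card_powersetCard, Finset.card_univ, Fintype.card_fin, nsmul_eq_mul,
            Nat.cast_mul]

theorem choose_le_exp {n w : ℕ} {t : ℝ} (ht : 0 < t) (h : t * n ≤ w) :
    (n.choose w : ℝ) ≤ Real.exp (w * (1 - Real.log t)) := by
  have h1 : (n.choose w : ℝ) ≤ n ^ w / w.factorial := Nat.choose_le_pow_div w n
  have h2 := Real.pow_div_factorial_le_exp (w : ℝ) (Nat.cast_nonneg w) w
  have h3 : (t * n) ^ w / w.factorial ≤ (w : ℝ) ^ w / w.factorial := by gcongr
  have h4 : Real.exp (w * (1 - Real.log t)) = Real.exp w / t ^ w := by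
    rw [mul_sub, mul_one, Real.exp_sub, Real.exp_nat_mul (Real.log t), Real.exp_log ht]
  rw [h4, le_div_iff₀ (pow_pos ht w)]
  calc n.choose w * t ^ w ≤ n ^ w / w.factorial * t ^ w := by gcongr
    _ = (t * n) ^ w / w.factorial := by
        rw [mul_pow]
        ring
    _ ≤ _ := h3.trans h2

theorem separator_main_exponent_le {d x : ℝ} (hd : 10 ≤ d)
    (hx : 0.015 * (d ^ 3 * Real.exp (-d)) ≤ x) (hx2 : x ≤ 1 / 2) :
    1 - Real.log x - d * (1 - x) ≤ -1.3 := by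
  have hd0 : 0 < d := by linarith
  set δ : ℝ := 0.015 * (d ^ 3 * Real.exp (-d)) with hδ
  have hδ0 : 0 < δ := by positivity
  have hconv : ConvexOn ℝ (Set.Ioi (0 : ℝ)) fun x => -Real.log x + d * x :=
    strictConcaveOn_log_Ioi.concaveOn.neg.add
      ((convexOn_id (convex_Ioi (0 : ℝ))).smul hd0.le)
  have hmax := hconv.le_max_of_mem_Icc (x := δ) (y := 1 / 2) (z := x) hδ0 (by norm_num) ⟨hx, hx2⟩
  have h10 : 2.3 ≤ Real.log d := by
    refine le_trans ?_ (Real.log_le_log (by norm_num) hd)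
    rw [Real.le_log_iff_exp_le (by norm_num)]
    have h1 := Real.exp_one_lt_d9
    have : Real.exp 2.3 ^ 10 ≤ 10 ^ 10 := by
      calc Real.exp 2.3 ^ 10 = Real.exp 1 ^ 23 := by
            rw [← Real.exp_nat_mul, ← Real.exp_nat_mul]
            norm_num
        _ ≤ 2.7182818286 ^ 23 := pow_le_pow_left₀ (Real.exp_pos _).le h1.le _
        _ ≤ _ := by norm_num
    exact le_of_pow_le_pow_left₀ (by norm_num) (by norm_num) this
  have hc : -4.2 ≤ Real.log 0.015 := by
    rw [Real.le_log_iff_exp_le (by norm_num), Real.exp_neg]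
    refine inv_le_of_inv_le₀ (by norm_num) ?_
    have h1 := Real.exp_one_gt_d9
    have : (1 / 0.015 : ℝ) ^ 5 ≤ Real.exp 4.2 ^ 5 := by
      calc (1 / 0.015 : ℝ) ^ 5 ≤ 2.7182818283 ^ 21 := by norm_num
        _ ≤ Real.exp 1 ^ 21 := pow_le_pow_left₀ (by norm_num) h1.le _
        _ = _ := by
            rw [← Real.exp_nat_mul, ← Real.exp_nat_mul]
            norm_num
    rw [← one_div]
    exact le_of_pow_le_pow_left₀ (by norm_num) (Real.exp_pos _).le this
  have hlδ : Real.log δ = Real.log 0.015 + (3 * Real.log d - d) := by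
    rw [hδ, Real.log_mul (by norm_num) (by positivity), Real.log_mul (by positivity)
      (Real.exp_ne_zero _), Real.log_exp, Real.log_pow]
    push_cast
    ring
  have hdδ : d * δ ≤ 0.36 := by
    have h1 := Real.pow_div_factorial_le_exp d hd0.le 4
    have h2 : Real.exp d * Real.exp (-d) = 1 := by rw [← Real.exp_add]; simp
    have h3 := mul_le_mul_of_nonneg_right h1 (Real.exp_pos (-d)).le
    rw [h2] at h3
    norm_num [Nat.factorial] at h3
    rw [hδ]
    nlinarith
  have hhalf : -Real.log (1 / 2) ≤ 0.6932 := by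
    rw [one_div, Real.log_inv, neg_neg]
    linarith [Real.log_two_lt_d9]
  rcases le_max_iff.1 hmax with h | h <;> linarith

end Separator

section SeparatorAsymptotics

theorem exp_neg_mul_le {d : ℝ} (hd : 10 ≤ d) : Real.exp (-d) * (1 + 2 * d) ≤ 0.001 := by
  have h10 := exp_ten_ge
  have h : 22026 * (1 + (d - 10)) ≤ Real.exp d := by
    rw [show d = 10 + (d - 10) by ring, Real.exp_add]
    refine mul_le_mul h10 ?_ (by linarith) (Real.exp_pos _).le
    linarith [Real.add_one_le_exp (d - 10)]
  rw [Real.exp_neg, inv_mul_le_iff₀ (Real.exp_pos _)]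
  linarith

theorem pow_three_mul_exp_neg_le {d : ℝ} (hd : 0 ≤ d) : d ^ 3 * Real.exp (-d) ≤ 6 := by
  have h1 := Real.pow_div_factorial_le_exp d hd 3
  rw [Real.exp_neg, ← div_eq_mul_inv, div_le_iff₀ (Real.exp_pos _)]
  norm_num [Nat.factorial] at h1
  linarith

theorem blue_density_eq (d : ℝ) : 0.1 * (2 * d) ^ 3 * Real.exp (-(2 * d))
    = 0.8 * (d ^ 3 * Real.exp (-d)) * Real.exp (-d) := by
  rw [show -(2 * d) = -d + -d by ring, Real.exp_add]
  ring

theorem separator_term_le {n w b : ℕ} {d : ℝ} (hd : 10 ≤ d) (hdn : d ≤ n)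
    (hw : 0.015 * (d ^ 3 * Real.exp (-d)) * n ≤ w) (hw2 : 2 * w ≤ n)
    (hb : 0.1 * (2 * d) ^ 3 * Real.exp (-(2 * d)) * n ≤ b)
    (hb2 : b ≤ 2 * (0.1 * (2 * d) ^ 3 * Real.exp (-(2 * d)) * n)) :
    (n.choose w : ℝ) * n.choose b * (1 - d / n) ^ (w * (n - w - b)) ≤ Real.exp (-w) := by
  have hd0 : 0 < d := by linarith
  have hn : (0 : ℝ) < n := hd0.trans_le hdn
  have hp1 : d / n ≤ 1 := (div_le_one hn).2 hdn
  have hp0 : 0 < d / n := div_pos hd0 hn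
  have hlogε : -(2 * d) ≤ Real.log (0.1 * (2 * d) ^ 3 * Real.exp (-(2 * d))) := by
    rw [Real.le_log_iff_exp_le (by positivity)]
    refine le_mul_of_one_le_left (Real.exp_pos _).le ?_
    have := pow_le_pow_left₀ (by norm_num) (show (20 : ℝ) ≤ 2 * d by linarith) 3
    norm_num at this ⊢
    linarith
  have c2 := choose_le_exp (by positivity) hb
  set ε : ℝ := 0.1 * (2 * d) ^ 3 * Real.exp (-(2 * d)) with hε
  have hεκ : ε = 0.8 * (d ^ 3 * Real.exp (-d)) * Real.exp (-d) := blue_density_eq d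
  have hE := exp_neg_mul_le hd
  have hκ6 := pow_three_mul_exp_neg_le hd0.le
  have hE0 := Real.exp_pos (-d)
  have hκ0 : 0 < d ^ 3 * Real.exp (-d) := by positivity
  have hw0 : (0 : ℝ) < w := lt_of_lt_of_le (by positivity) hw
  have hw2R : (2 * w : ℝ) ≤ n := by exact_mod_cast hw2
  have c1 := choose_le_exp (n := n) (w := w) (t := w / n) (by positivity)
    (by rw [div_mul_cancel₀ _ hn.ne'])
  have c3 : (1 - d / n) ^ (w * (n - w - b)) ≤ Real.exp (-(d / n * (w * (n - w - b)))) := by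
    calc (1 - d / n) ^ (w * (n - w - b)) ≤ Real.exp (-(d / n)) ^ (w * (n - w - b)) := by
          refine pow_le_pow_left₀ (by linarith) ?_ _
          linarith [Real.add_one_le_exp (-(d / n))]
      _ = Real.exp (-(d / n * ((w * (n - w - b) : ℕ) : ℝ))) := by
          rw [← Real.exp_nat_mul]
          ring_nf
      _ ≤ _ := by
          refine Real.exp_le_exp.2 (neg_le_neg (mul_le_mul_of_nonneg_left ?_ hp0.le))
          rw [Nat.cast_mul]
          refine mul_le_mul_of_nonneg_left ?_ hw0.le
          have : n ≤ (n - w - b) + w + b := by omega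
          have : (n : ℝ) ≤ ((n - w - b : ℕ) : ℝ) + w + b := by exact_mod_cast this
          linarith
  have hmain := separator_main_exponent_le (x := w / n) hd (by rwa [le_div_iff₀ hn])
    (by rw [div_le_iff₀ hn]; linarith)
  have hmain' := mul_le_mul_of_nonneg_left hmain hw0.le
  have t1 : d / n * (w * b) ≤ 0.01 * w := by
    rw [div_mul_eq_mul_div, div_le_iff₀ hn]
    have h1 : d * ε ≤ 0.005 := by
      rw [hεκ]
      nlinarith
    have h2 : d * b ≤ 0.01 * n := by nlinarith
    nlinarith
  have t2 : b * (1 - Real.log ε) ≤ 0.2 * w := by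
    have h1 : ε * (1 + 2 * d) ≤ 0.0008 * (d ^ 3 * Real.exp (-d)) := by
      rw [hεκ]
      nlinarith
    calc b * (1 - Real.log ε) ≤ (2 * (ε * n)) * (1 + 2 * d) :=
          mul_le_mul hb2 (by linarith) (by
            have : Real.log ε ≤ 0 := by
              refine Real.log_nonpos (by positivity) ?_
              rw [hεκ]
              nlinarith
            linarith) (by positivity)
      _ = 2 * (ε * (1 + 2 * d)) * n := by ring
      _ ≤ 2 * (0.0008 * (d ^ 3 * Real.exp (-d))) * n := by gcongr
      _ ≤ _ := by
        have : 0 < d ^ 3 * Real.exp (-d) * n := by positivity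
        linarith
  calc _ ≤ Real.exp (w * (1 - Real.log (w / n))) * Real.exp (b * (1 - Real.log ε))
        * Real.exp (-(d / n * (w * (n - w - b)))) :=
        mul_le_mul (mul_le_mul c1 c2 (by positivity) (Real.exp_pos _).le) c3
          (pow_nonneg (by linarith) _) (by positivity)
    _ = Real.exp (w * (1 - Real.log (w / n)) + b * (1 - Real.log ε)
        + -(d / n * (w * (n - w - b)))) := by rw [Real.exp_add, Real.exp_add]
    _ ≤ _ := by
        refine Real.exp_le_exp.2 ?_
        have e : d / n * (w * (n - w - b)) = w * (d * (1 - w / n)) - d / n * (w * b) := by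
          field_simp
        rw [e]
        linarith

theorem prG_few_blue_le {n : ℕ} {d : ℝ} (hd : 10 ≤ d) (hdn : d ≤ n)
    (hn : 1 ≤ 0.1 * (2 * d) ^ 3 * Real.exp (-(2 * d)) * n) :
    prG n (d / n) (fun G => n ≤ 2 * (strongCore G 4).ncard ∧
      0.02 * (d ^ 3 * Real.exp (-d)) * n ≤ ({v | {u | G.Adj v u}.ncard ≤ 3}.ncard : ℝ) ∧
      ((strongBlue G 4).ncard : ℝ) < 0.1 * (2 * d) ^ 3 * Real.exp (-(2 * d)) * n)
      ≤ n * Real.exp (-(0.015 * (d ^ 3 * Real.exp (-d)) * n)) := by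
  have hd0 : 0 < d := by linarith
  have hn0 : (0 : ℝ) < n := hd0.trans_le hdn
  have hp1 : d / n ≤ 1 := (div_le_one hn0).2 hdn
  have hp0 : 0 < d / n := div_pos hd0 hn0
  set β : ℝ := 0.1 * (2 * d) ^ 3 * Real.exp (-(2 * d)) * n with hβ
  have hβκ : β = 0.8 * (d ^ 3 * Real.exp (-d) * n) * Real.exp (-d) := by
    rw [hβ, blue_density_eq]
    ring
  have hE : Real.exp (-d) ≤ 0.001 := by
    refine le_trans ?_ (exp_neg_mul_le hd)
    exact le_mul_of_one_le_right (Real.exp_pos _).le (by linarith)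
  have hκ6 := pow_three_mul_exp_neg_le hd0.le
  have hκn : 0 < d ^ 3 * Real.exp (-d) * n := by positivity
  have hβ1 : β ≤ 0.001 * (d ^ 3 * Real.exp (-d) * n) := by
    rw [hβκ]
    nlinarith
  have hb1 := Nat.le_ceil β
  have hb2 := Nat.ceil_lt_add_one (zero_le_one.trans hn)
  set b := ⌈β⌉₊ with hb
  have hb3 : (b : ℝ) ≤ 2 * β := by linarith
  have hbn : 2 * b ≤ n := by
    have : (2 * b : ℝ) ≤ n := by nlinarith
    exact_mod_cast this
  let s : Finset ℕ := (Finset.Icc 1 n).filter fun w =>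
    0.015 * (d ^ 3 * Real.exp (-d)) * n ≤ (w : ℝ) ∧ 2 * w ≤ n
  refine (prG_exists_le hp0.le hp1 s _ (fun w G => ∃ W B : Finset (Fin n), W.card = w ∧
    B.card = b ∧ ∀ v ∈ W, ∀ u, u ∉ W ∪ B → ¬ G.Adj v u) ?_).trans ?_
  · rintro G ⟨hS, hL, hB⟩
    have hBb : (strongBlue G 4).ncard ≤ b := by
      have : ((strongBlue G 4).ncard : ℝ) ≤ b := hB.le.trans hb1
      exact_mod_cast this
    obtain ⟨W, B, h1, h2, h3, h4⟩ := exists_separator G hS hBb hbn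
    have h1R : ({v | {u | G.Adj v u}.ncard ≤ 3}.ncard : ℝ) ≤ W.card + b := by exact_mod_cast h1
    have hδ : 0.015 * (d ^ 3 * Real.exp (-d)) * n ≤ (W.card : ℝ) := by linarith
    have hW0 : (0 : ℝ) < W.card := lt_of_lt_of_le (by positivity) hδ
    exact ⟨W.card, Finset.mem_filter.2 ⟨Finset.mem_Icc.2 ⟨by exact_mod_cast hW0, by omega⟩,
      hδ, h2⟩, W, B, rfl, h3, h4⟩
  · calc _ ≤ ∑ w ∈ s, Real.exp (-(0.015 * (d ^ 3 * Real.exp (-d)) * n)) := by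
          refine Finset.sum_le_sum fun w hw => ?_
          have hw := (Finset.mem_filter.1 hw).2
          refine (prG_separator_le hp0.le hp1 w b).trans
            ((separator_term_le hd hdn hw.1 hw.2 hb1 hb3).trans ?_)
          exact Real.exp_le_exp.2 (neg_le_neg hw.1)
      _ ≤ _ := by
          rw [Finset.sum_const, nsmul_eq_mul]
          refine mul_le_mul_of_nonneg_right ?_ (Real.exp_pos _).le
          have := Finset.card_filter_le (Finset.Icc 1 n) fun w =>
            0.015 * (d ^ 3 * Real.exp (-d)) * n ≤ (w : ℝ) ∧ 2 * w ≤ n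
          rw [Nat.card_Icc, Nat.add_sub_cancel] at this
          exact_mod_cast this

end SeparatorAsymptotics

/-- Let `d ≥ 10` be a constant and `G ~ G(n, d/n)`.  Then with
probability `1 − o(n⁻¹)` one has `|V_{4,blue}(G)| ≥ 0.1·(2d)³·e^{−2d}·n`. -/
theorem strongBlue_large (d : ℝ) (hd : 10 ≤ d) :
    Tendsto
      (fun n : ℕ => (n : ℝ) *
        prG n (d / n) (fun G =>
          ¬ (0.1 * (2 * d) ^ 3 * Real.exp (-(2 * d)) * n ≤ ((strongBlue G 4).ncard : ℝ))))
      atTop (nhds 0) := by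
  have hd0 : 0 < d := by linarith
  have hκ : 0 < 0.015 * (d ^ 3 * Real.exp (-d)) := by positivity
  have hlim := ((tendsto_mul_prG_small_core hd).add (tendsto_mul_prG_few_low_degree hd0)).add
    (tendsto_pow_mul_exp_neg_mul 2 hκ)
  rw [add_zero, add_zero] at hlim
  have hε : 0 < 0.1 * (2 * d) ^ 3 * Real.exp (-(2 * d)) := by positivity
  have hcast : Tendsto (fun n : ℕ => (n : ℝ)) atTop atTop := tendsto_natCast_atTop_atTop
  refine squeeze_zero' ?_ ?_ hlim
  · filter_upwards [hcast.eventually_ge_atTop d] with n hdn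
    have hn : (0 : ℝ) < n := hd0.trans_le hdn
    exact mul_nonneg hn.le (prG_nonneg (div_pos hd0 hn).le ((div_le_one hn).2 hdn) _)
  · filter_upwards [hcast.eventually_ge_atTop d,
      (hcast.const_mul_atTop hε).eventually_ge_atTop 1] with n hdn hn1
    have hn : (0 : ℝ) < n := hd0.trans_le hdn
    have hp0 : 0 ≤ d / n := (div_pos hd0 hn).le
    have hp1 : d / n ≤ 1 := (div_le_one hn).2 hdn
    rw [sq, mul_assoc (n : ℝ) n, ← mul_add, ← mul_add]
    refine mul_le_mul_of_nonneg_left ?_ hn.le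
    refine (prG_mono hp0 hp1 fun G hG => ?_).trans ((prG_or_le hp0 hp1 _ _).trans
      (add_le_add (prG_or_le hp0 hp1 _ _) (prG_few_blue_le hd hdn hn1)))
    rw [not_le] at hG
    by_cases h1 : 2 * (strongCore G 4).ncard < n
    · exact Or.inl (Or.inl h1)
    by_cases h2 : ({v | {u | G.Adj v u}.ncard ≤ 3}.ncard : ℝ)
        < 0.02 * (d ^ 3 * Real.exp (-d)) * n
    · exact Or.inl (Or.inr h2)
    exact Or.inr ⟨not_lt.1 h1, not_lt.1 h2, hG⟩
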